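/- arXiv:1810.11323 — 4 statements merged into one kernel-verified Lean document; each statement's English description precedes it below -/
import Mathlib

section
/- Let m ≥ 2 be an integer, c ∈ ℝ, α > 0, and let p(n) ∈ [0,1] be a sequence such that p(n) ≥ (1+α)·(log n + c)/n for all sufficiently large n. Then there exists a constant C > 0 such that the probability that B_m(n, p(n)) is primitive and has exponent at most C·n·log n tends to 1 as n → ∞. -/
open Matrix Filter

/-- The 0/1 matrix (over `ℕ`) associated to a Boolean matrix of entries. -/
def toMat {n : ℕ} (b : Fin n → Fin n → Bool) : Matrix (Fin n) (Fin n) ℕ :=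
  Matrix.of fun i j => if b i j then 1 else 0

open Classical in
/-- The probability that the random set `B_m(n, p)` of `m` independent random `n × n`
binary matrices, whose `m · n²` entries are i.i.d. Bernoulli(`p`), satisfies `E`. -/
noncomputable def bernoulliProb (n m : ℕ) (p : ℝ)
    (E : (Fin m → Matrix (Fin n) (Fin n) ℕ) → Prop) : ℝ :=
  ∑ b : Fin m → Fin n → Fin n → Bool,
    if E (fun k => toMat (b k)) then
      ∏ k : Fin m, ∏ i : Fin n, ∏ j : Fin n, (if b k i j then p else 1 - p)
    else 0

lemma mat_mul_pos {n : ℕ} (A B : Matrix (Fin n) (Fin n) ℕ) {i k j : Fin n}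
    (h1 : 0 < A i k) (h2 : 0 < B k j) : 0 < (A * B) i j := by
  rw [Matrix.mul_apply]
  exact Finset.sum_pos' (fun _ _ => Nat.zero_le _) ⟨k, Finset.mem_univ _, Nat.mul_pos h1 h2⟩

lemma row_pos {n : ℕ} (A : Matrix (Fin n) (Fin n) ℕ) (v : Fin n) (hv : 0 < A v v)
    (hcut : ∀ S : Finset (Fin n), S.Nonempty → S ≠ Finset.univ →
      ∃ i ∈ S, ∃ j ∉ S, 0 < A i j) : ∀ j, 0 < (A ^ n) v j := by
  classical
  have key : ∀ l : ℕ, 0 < (A ^ l) v v ∧ ((∀ j, 0 < (A ^ l) v j) ∨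
      l + 1 ≤ (Finset.univ.filter (fun j => 0 < (A ^ l) v j)).card) := by
    intro l
    induction l with
    | zero =>
      refine ⟨by simp, Or.inr ?_⟩
      rw [zero_add, Finset.one_le_card]
      exact ⟨v, by simp⟩
    | succ l ih =>
      obtain ⟨h0, h⟩ := ih
      have mono : ∀ j, 0 < (A ^ l) v j → 0 < (A ^ (l + 1)) v j := by
        intro j hj
        rw [pow_succ']
        exact mat_mul_pos _ _ hv hj
      refine ⟨mono v h0, ?_⟩
      rcases h with h | h
      · exact Or.inl fun j => mono j (h j)
      · by_cases hu : Finset.univ.filter (fun j => 0 < (A ^ l) v j) = Finset.univ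
        · left
          intro j
          apply mono
          have : j ∈ Finset.univ.filter (fun j => 0 < (A ^ l) v j) := by rw [hu]; simp
          simpa using this
        · right
          obtain ⟨i, hi, j, hj, hij⟩ := hcut _ ⟨v, by simpa using h0⟩ hu
          have hlt : Finset.univ.filter (fun j => 0 < (A ^ l) v j) ⊂
              Finset.univ.filter (fun j => 0 < (A ^ (l + 1)) v j) := by
            rw [Finset.ssubset_iff_of_subset]
            · refine ⟨j, ?_, hj⟩
              rw [Finset.mem_filter]
              refine ⟨Finset.mem_univ _, ?_⟩
              rw [pow_succ]
              rw [Finset.mem_filter] at hi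
              exact mat_mul_pos _ _ hi.2 hij
            · intro x hx
              rw [Finset.mem_filter] at hx ⊢
              exact ⟨hx.1, mono x hx.2⟩
          have := Finset.card_lt_card hlt
          omega
  rcases (key n).2 with h | h
  · exact h
  · have := Finset.card_le_univ (Finset.univ.filter (fun j => 0 < (A ^ n) v j))
    simp only [Fintype.card_fin] at this
    omega

lemma all_pos {n : ℕ} (A : Matrix (Fin n) (Fin n) ℕ) (v : Fin n) (hv : 0 < A v v)
    (hcut : ∀ S : Finset (Fin n), S.Nonempty → S ≠ Finset.univ →
      ∃ i ∈ S, ∃ j ∉ S, 0 < A i j) : ∀ i j, 0 < (A ^ (2 * n)) i j := by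
  intro i j
  rw [two_mul, pow_add]
  refine mat_mul_pos _ _ (k := v) ?_ (row_pos A v hv hcut j)
  have := row_pos Aᵀ v hv (fun S hS hS' => by
    obtain ⟨a, ha, b, hb, hab⟩ := hcut Sᶜ
      (by rwa [Finset.nonempty_iff_ne_empty, Ne, Finset.compl_eq_empty_iff])
      (by rw [Ne, Finset.compl_eq_univ_iff]; exact hS.ne_empty)
    exact ⟨b, by simpa using hb, a, by simpa using ha, hab⟩) i
  rwa [← Matrix.transpose_pow] at this

lemma sum_prod3 {n m : ℕ} (f : Fin m → Fin n → Fin n → Bool → ℝ) :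
    ∑ b : Fin m → Fin n → Fin n → Bool, ∏ k, ∏ i, ∏ j, f k i j (b k i j)
      = ∏ k, ∏ i, ∏ j, (f k i j true + f k i j false) := by
  rw [← Fintype.prod_sum (fun k (b : Fin n → Fin n → Bool) => ∏ i, ∏ j, f k i j (b i j))]
  refine Finset.prod_congr rfl fun k _ => ?_
  rw [← Fintype.prod_sum (fun i (b : Fin n → Bool) => ∏ j, f k i j (b j))]
  refine Finset.prod_congr rfl fun i _ => ?_
  rw [← Fintype.prod_sum (fun j (b : Bool) => f k i j b)]
  simp

/-- the weight of a configuration -/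
noncomputable def wt {n m : ℕ} (p : ℝ) (b : Fin m → Fin n → Fin n → Bool) : ℝ :=
  ∏ k : Fin m, ∏ i : Fin n, ∏ j : Fin n, (if b k i j then p else 1 - p)

lemma wt_nonneg {n m : ℕ} {p : ℝ} (hp : p ∈ Set.Icc (0 : ℝ) 1)
    (b : Fin m → Fin n → Fin n → Bool) : 0 ≤ wt p b := by
  unfold wt
  refine Finset.prod_nonneg fun k _ => Finset.prod_nonneg fun i _ =>
    Finset.prod_nonneg fun j _ => ?_
  split_ifs <;> linarith [hp.1, hp.2]

lemma wt_sum {n m : ℕ} (p : ℝ) : ∑ b : Fin m → Fin n → Fin n → Bool, wt p b = 1 := by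
  unfold wt
  rw [sum_prod3 (fun _ _ _ x => if x then p else 1 - p)]
  simp

open Classical in
lemma wt_vanish {n m : ℕ} (p : ℝ) (k₀ : Fin m) (T : Finset (Fin n × Fin n)) :
    ∑ b : Fin m → Fin n → Fin n → Bool,
      (if ∀ x ∈ T, b k₀ x.1 x.2 = false then wt p b else 0) = (1 - p) ^ T.card := by
  have h1 : ∀ b : Fin m → Fin n → Fin n → Bool,
      (if ∀ x ∈ T, b k₀ x.1 x.2 = false then wt p b else 0) =
      ∏ k, ∏ i, ∏ j, (fun k i j (x : Bool) =>
        if x then (if k = k₀ ∧ (i, j) ∈ T then 0 else p) else 1 - p) k i j (b k i j) := by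
    intro b
    split_ifs with h
    · unfold wt
      refine Finset.prod_congr rfl fun k _ => Finset.prod_congr rfl fun i _ =>
        Finset.prod_congr rfl fun j _ => ?_
      by_cases hb : b k i j = true
      · have : ¬ (k = k₀ ∧ (i, j) ∈ T) := by
          rintro ⟨rfl, hT⟩
          have := h _ hT
          simp_all
        simp [hb, this]
      · simp [hb]
    · push Not at h
      obtain ⟨x, hx, hb⟩ := h
      symm
      refine Finset.prod_eq_zero (Finset.mem_univ k₀) ?_
      refine Finset.prod_eq_zero (Finset.mem_univ x.1) ?_
      refine Finset.prod_eq_zero (Finset.mem_univ x.2) ?_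
      simp [hx, hb]
  rw [Finset.sum_congr rfl fun b _ => h1 b, sum_prod3 (fun k i j (x : Bool) =>
        if x then (if k = k₀ ∧ (i, j) ∈ T then 0 else p) else 1 - p)]
  have h2 : ∀ k i j, ((fun (k : Fin m) (i j : Fin n) (x : Bool) =>
        if x then (if k = k₀ ∧ (i, j) ∈ T then 0 else p) else 1 - p) k i j true +
      (fun (k : Fin m) (i j : Fin n) (x : Bool) =>
        if x then (if k = k₀ ∧ (i, j) ∈ T then 0 else p) else 1 - p) k i j false)
      = if k = k₀ then (if (i, j) ∈ T then 1 - p else 1) else 1 := by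
    intro k i j
    by_cases hk : k = k₀ <;> by_cases hT : (i, j) ∈ T <;> simp [hk, hT]
  rw [Finset.prod_congr rfl fun k _ => Finset.prod_congr rfl fun i _ =>
    Finset.prod_congr rfl fun j _ => h2 k i j]
  rw [Finset.prod_eq_single k₀]
  · simp only [if_true]
    rw [← Fintype.prod_prod_type' (fun i j => if (i, j) ∈ T then 1 - p else 1)]
    simp only [Prod.mk.eta]
    rw [Finset.prod_ite_mem]
    simp
  · intro k _ hk
    simp [hk]
  · simp

/-- the union bound -/
lemma prob_lower {n m : ℕ} (hm : 0 < m) {p : ℝ} (hp : p ∈ Set.Icc (0 : ℝ) 1)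
    (E : (Fin m → Matrix (Fin n) (Fin n) ℕ) → Prop)
    (hE : ∀ M, (∀ i j, 0 < (M ⟨0, hm⟩ ^ (2 * n)) i j) → E M) :
    1 - (1 - p) ^ n - ∑ k ∈ Finset.Ico 1 n, (n.choose k : ℝ) * (1 - p) ^ (k * (n - k))
      ≤ bernoulliProb n m p E := by
  classical
  set k₀ : Fin m := ⟨0, hm⟩
  set D : Finset (Fin n × Fin n) := Finset.univ.image (fun v => (v, v))
  set F : Finset (Finset (Fin n)) :=
    Finset.univ.filter (fun S => 1 ≤ S.card ∧ S.card < n)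
  have hD : D.card = n := by
    rw [Finset.card_image_of_injective _ (fun a b h => by simpa using h)]
    simp
  have hpt : ∀ b : Fin m → Fin n → Fin n → Bool,
      wt p b ≤ (if E (fun k => toMat (b k)) then wt p b else 0) +
        (if ∀ x ∈ D, b k₀ x.1 x.2 = false then wt p b else 0) +
        ∑ S ∈ F, (if ∀ x ∈ S ×ˢ Sᶜ, b k₀ x.1 x.2 = false then wt p b else 0) := by
    intro b
    have hw := wt_nonneg hp b
    have hs : 0 ≤ ∑ S ∈ F, (if ∀ x ∈ S ×ˢ Sᶜ, b k₀ x.1 x.2 = false then wt p b else 0) :=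
      Finset.sum_nonneg fun S _ => by split_ifs <;> simp [hw]
    by_cases h1 : E (fun k => toMat (b k))
    · rw [if_pos h1]
      have : 0 ≤ (if ∀ x ∈ D, b k₀ x.1 x.2 = false then wt p b else 0) := by
        split_ifs <;> simp [hw]
      linarith
    by_cases h2 : ∀ x ∈ D, b k₀ x.1 x.2 = false
    · rw [if_neg h1, if_pos h2]
      linarith
    rw [if_neg h1, if_neg h2, zero_add, zero_add]
    have h3 : ∃ S ∈ F, ∀ x ∈ S ×ˢ Sᶜ, b k₀ x.1 x.2 = false := by
      by_contra hcon
      push Not at hcon h2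
      apply h1
      apply hE
      obtain ⟨x, hx, hxb⟩ := h2
      obtain ⟨v, -, rfl⟩ := Finset.mem_image.1 hx
      refine all_pos _ v ?_ ?_
      · simp only [ne_eq, Bool.not_eq_false] at hxb
        simp [toMat, k₀] at hxb ⊢
        simp [hxb]
      · intro S hS hS'
        obtain ⟨x, hx, hxb⟩ := hcon S (by
          simp only [F, Finset.mem_filter, Finset.mem_univ, true_and]
          refine ⟨Finset.one_le_card.2 hS, ?_⟩
          have := (Finset.card_lt_iff_ne_univ S).2 hS'
          simpa using this)
        simp only [Finset.mem_product, Finset.mem_compl] at hx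
        refine ⟨x.1, hx.1, x.2, hx.2, ?_⟩
        simp [toMat, k₀] at hxb ⊢
        simp [hxb]
    obtain ⟨S, hS, hSb⟩ := h3
    have := Finset.single_le_sum (f := fun S => (if ∀ x ∈ S ×ˢ Sᶜ, b k₀ x.1 x.2 = false
      then wt p b else 0)) (fun S _ => by split_ifs <;> simp [hw]) hS
    simpa only [if_pos hSb] using this
  have hsum := Finset.sum_le_sum (s := Finset.univ) fun b _ => hpt b
  rw [wt_sum, Finset.sum_add_distrib, Finset.sum_add_distrib, wt_vanish, hD,
    Finset.sum_comm] at hsum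
  simp_rw [wt_vanish] at hsum
  have hb : ∑ b : Fin m → Fin n → Fin n → Bool,
      (if E (fun k => toMat (b k)) then wt p b else 0) = bernoulliProb n m p E := by
    unfold bernoulliProb wt
    refine Finset.sum_congr rfl fun b _ => ?_
    congr
  have hF : ∑ S ∈ F, (1 - p) ^ (S ×ˢ Sᶜ).card =
      ∑ k ∈ Finset.Ico 1 n, (n.choose k : ℝ) * (1 - p) ^ (k * (n - k)) := by
    have := Finset.sum_powerset_apply_card
      (fun k => if 1 ≤ k ∧ k < n then (1 - p) ^ (k * (n - k)) else 0)
      (x := (Finset.univ : Finset (Fin n)))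
    simp only [Finset.powerset_univ, Finset.card_univ, Fintype.card_fin, nsmul_eq_mul] at this
    rw [Finset.sum_filter]
    simp only [Finset.card_product, Finset.card_compl, Fintype.card_fin]
    rw [this]
    simp only [mul_ite, mul_zero]
    rw [← Finset.sum_filter]
    refine Finset.sum_congr ?_ fun _ _ => rfl
    ext k
    simp
    omega
  rw [hb, hF] at hsum
  linarith

/-- termwise bound for small `k` -/
lemma term_small {n k : ℕ} (h2 : 2 * k ≤ n) (hk : 1 ≤ k) {L δ q t : ℝ}
    (hL : 0 ≤ L) (hδ : 0 < δ) (hq0 : 0 ≤ q) (hq : q ≤ Real.exp (-(L / n)))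
    (ht1 : t ≤ 1)
    (hr : (n : ℝ) * Real.exp (-(L * (1 - δ))) ≤ t) (hs : 2 * Real.exp (-(L * δ / 2)) ≤ t) :
    (n.choose k : ℝ) * q ^ (k * (n - k)) ≤ t ^ k := by
  have hn : (0 : ℝ) < n := by exact_mod_cast (by omega : 0 < n)
  have hkn : k ≤ n := by omega
  have ht0 : 0 ≤ t := le_trans (by positivity) hs
  have h2' : 2 * (k : ℝ) ≤ n := by exact_mod_cast h2
  by_cases hc : (k : ℝ) ≤ δ * n
  · have hch : (n.choose k : ℝ) ≤ (n : ℝ) ^ k := by exact_mod_cast Nat.choose_le_pow n k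
    calc (n.choose k : ℝ) * q ^ (k * (n - k)) ≤ (n : ℝ) ^ k * (q ^ (n - k)) ^ k := by
          rw [← pow_mul, mul_comm (n - k) k]
          gcongr
      _ = (n * q ^ (n - k)) ^ k := by rw [mul_pow]
      _ ≤ t ^ k := by
          refine pow_le_pow_left₀ (by positivity) (le_trans ?_ hr) k
          refine mul_le_mul_of_nonneg_left ?_ hn.le
          refine (pow_le_pow_left₀ hq0 hq _).trans ?_
          rw [← Real.exp_nat_mul, Real.exp_le_exp, Nat.cast_sub hkn]
          have : L / n * n = L := by field_simp
          have h3 : L / n * k ≤ L / n * (δ * n) := by gcongr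
          have h4 : L / n * (δ * n) = L * δ := by field_simp
          nlinarith
  · push Not at hc
    have hch : (n.choose k : ℝ) ≤ 2 ^ n := by exact_mod_cast Nat.choose_le_two_pow n k
    calc (n.choose k : ℝ) * q ^ (k * (n - k)) ≤ 2 ^ n * Real.exp (-(L * δ / 2)) ^ n := by
          refine mul_le_mul hch ?_ (by positivity) (by positivity)
          refine (pow_le_pow_left₀ hq0 hq _).trans ?_
          rw [← Real.exp_nat_mul, ← Real.exp_nat_mul, Real.exp_le_exp, Nat.cast_mul,
            Nat.cast_sub hkn]
          have h3 : δ * n * (n / 2) ≤ (k : ℝ) * (n - k) := by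
            refine mul_le_mul hc.le (by linarith) (by positivity) (by positivity)
          have h4 : L / n * (δ * n * (n / 2)) ≤ L / n * ((k : ℝ) * (n - k)) := by gcongr
          have h5 : L / n * (δ * n * (n / 2)) = n * (L * δ / 2) := by field_simp
          linarith
      _ = (2 * Real.exp (-(L * δ / 2))) ^ n := by rw [mul_pow]
      _ ≤ t ^ n := pow_le_pow_left₀ (by positivity) hs n
      _ ≤ t ^ k := pow_le_pow_of_le_one ht0 ht1 hkn

lemma sum_bound {n : ℕ} {L δ q t : ℝ}
    (hL : 0 ≤ L) (hδ : 0 < δ) (hq0 : 0 ≤ q) (hq : q ≤ Real.exp (-(L / n)))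
    (ht1 : t ≤ 1 / 2)
    (hr : (n : ℝ) * Real.exp (-(L * (1 - δ))) ≤ t) (hs : 2 * Real.exp (-(L * δ / 2)) ≤ t) :
    ∑ k ∈ Finset.Ico 1 n, (n.choose k : ℝ) * q ^ (k * (n - k)) ≤ 4 * t := by
  have ht0 : 0 ≤ t := le_trans (by positivity) hs
  have hterm : ∀ k ∈ Finset.Ico 1 n, (n.choose k : ℝ) * q ^ (k * (n - k)) ≤
      t ^ k + t ^ (n - k) := by
    intro k hk
    rw [Finset.mem_Ico] at hk
    by_cases h : 2 * k ≤ n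
    · have := term_small h hk.1 hL hδ hq0 hq (by linarith) hr hs
      have : 0 ≤ t ^ (n - k) := by positivity
      linarith
    · have := term_small (n := n) (k := n - k) (by omega) (by omega) hL hδ hq0 hq
        (by linarith) hr hs
      rw [Nat.choose_symm hk.2.le, Nat.sub_sub_self hk.2.le, mul_comm (n - k) k] at this
      have : 0 ≤ t ^ k := by positivity
      linarith
  have hg : ∑ k ∈ Finset.Ico 1 n, t ^ k ≤ 2 * t := by
    have h1 : ∀ k ∈ Finset.Ico 1 n, t ^ k ≤ t * (1 / 2) ^ (k - 1) := by
      intro k hk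
      rw [Finset.mem_Ico] at hk
      obtain ⟨j, rfl⟩ : ∃ j, k = j + 1 := ⟨k - 1, by omega⟩
      rw [pow_succ', Nat.add_sub_cancel]
      gcongr
    refine (Finset.sum_le_sum h1).trans ?_
    rw [← Finset.mul_sum, Finset.sum_Ico_eq_sum_range, mul_comm 2 t]
    refine mul_le_mul_of_nonneg_left ?_ ht0
    simp only [Nat.add_sub_cancel_left]
    exact sum_geometric_two_le _
  have hg' : ∑ k ∈ Finset.Ico 1 n, t ^ (n - k) = ∑ k ∈ Finset.Ico 1 n, t ^ k := by
    refine Finset.sum_bij' (fun k _ => n - k) (fun k _ => n - k) ?_ ?_ ?_ ?_ ?_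
    all_goals intro k hk; simp only [Finset.mem_Ico] at *
    any_goals omega
  have := Finset.sum_le_sum hterm
  rw [Finset.sum_add_distrib, hg'] at this
  linarith

lemma prob_le_one {n m : ℕ} {p : ℝ} (hp : p ∈ Set.Icc (0 : ℝ) 1)
    (E : (Fin m → Matrix (Fin n) (Fin n) ℕ) → Prop) : bernoulliProb n m p E ≤ 1 := by
  classical
  rw [← wt_sum (n := n) (m := m) p]
  unfold bernoulliProb
  refine Finset.sum_le_sum fun b _ => ?_
  split_ifs
  · exact le_rfl
  · exact wt_nonneg hp b

/-- Let `m ≥ 2`, `c ∈ ℝ`, `α > 0`, and let `p n ∈ [0,1]` satisfy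
`p n ≥ (1+α)·(log n + c)/n` for all sufficiently large `n`.  Then there is a constant
`C > 0` such that the probability that `B_m(n, p n)` is primitive with exponent at most
`C · n · log n` (i.e. admits a nonempty positive product of that length) tends to `1`. -/
theorem stmt2 (m : ℕ) (hm : 2 ≤ m) (c α : ℝ) (hα : 0 < α)
    (p : ℕ → ℝ) (hp : ∀ n, p n ∈ Set.Icc (0 : ℝ) 1)
    (hlarge : ∀ᶠ n : ℕ in atTop, (1 + α) * (Real.log n + c) / n ≤ p n) :
    ∃ C : ℝ, 0 < C ∧
      Tendsto (fun n : ℕ => bernoulliProb n m (p n)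
        (fun M => ∃ w : List (Fin m), w ≠ [] ∧
          (w.length : ℝ) ≤ C * n * Real.log n ∧
          ∀ i j, 0 < (w.map M).prod i j)) atTop (nhds 1) := by
  refine ⟨2, by norm_num, ?_⟩
  have hlog : Tendsto (fun n : ℕ => Real.log n + c) atTop atTop :=
    tendsto_atTop_add_const_right _ _
      (Real.tendsto_log_atTop.comp tendsto_natCast_atTop_atTop)
  obtain ⟨δ, hδdef⟩ : ∃ δ : ℝ, δ = α / (2 * (1 + α)) := ⟨_, rfl⟩
  have hδ : 0 < δ := by rw [hδdef]; positivity
  have hδ1 : (1 + α) * (1 - δ) = 1 + α / 2 := by rw [hδdef]; field_simp; ring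
  have hδ2 : (1 + α) * δ = α / 2 := by rw [hδdef]; field_simp
  have hδ3 : 0 < 1 - δ := by
    by_contra h
    push Not at h
    nlinarith
  obtain ⟨t, htdef⟩ : ∃ t : ℕ → ℝ, t = fun n : ℕ =>
    Real.exp (-c) * Real.exp (-(α / 2 * (Real.log n + c)))
    + 2 * Real.exp (-(α / 4 * (Real.log n + c))) := ⟨_, rfl⟩
  have ht : Tendsto t atTop (nhds 0) := by
    have h1 : ∀ a : ℝ, 0 < a →
        Tendsto (fun n : ℕ => Real.exp (-(a * (Real.log n + c)))) atTop (nhds 0) := fun a ha =>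
      Real.tendsto_exp_neg_atTop_nhds_zero.comp (hlog.const_mul_atTop ha)
    have := ((h1 (α / 2) (by positivity)).const_mul (Real.exp (-c))).add
      ((h1 (α / 4) (by positivity)).const_mul 2)
    rw [htdef]
    simpa using this
  have hlow : Tendsto (fun n => 1 - 5 * t n) atTop (nhds 1) := by
    simpa using (ht.const_mul 5).const_sub 1
  refine tendsto_of_tendsto_of_tendsto_of_le_of_le' hlow tendsto_const_nhds ?_
    (Eventually.of_forall fun n => prob_le_one (hp n) _)
  filter_upwards [hlarge, hlog.eventually_ge_atTop 0, eventually_ge_atTop 3,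
    ht.eventually_le_const (show (0 : ℝ) < 1 / 2 by norm_num)] with n hn hu hn3 ht2
  have hn0 : (0 : ℝ) < n := by exact_mod_cast (by omega : 0 < n)
  have hlog1 : 1 ≤ Real.log n := by
    rw [Real.le_log_iff_exp_le hn0]
    have : (3 : ℝ) ≤ n := by exact_mod_cast hn3
    linarith [Real.exp_one_lt_d9]
  obtain ⟨hp0, hp1⟩ := hp n
  rw [div_le_iff₀ hn0] at hn
  have hL : 0 ≤ p n * n := by positivity
  have hq : 1 - p n ≤ Real.exp (-(p n * n / n)) := by
    have h1 : p n * n / n = p n := by field_simp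
    rw [h1]
    linarith [Real.add_one_le_exp (-(p n))]
  have e1 : 0 < Real.exp (-c) * Real.exp (-(α / 2 * (Real.log n + c))) := by positivity
  have e2 : 0 < Real.exp (-(α / 4 * (Real.log n + c))) := by positivity
  have hδL : α / 2 * (Real.log n + c) ≤ p n * n * δ := by
    have := mul_le_mul_of_nonneg_right hn hδ.le
    linear_combination this - (Real.log n + c) * hδ2
  have hr : (n : ℝ) * Real.exp (-(p n * n * (1 - δ))) ≤ t n := by
    have h1 : (n : ℝ) * Real.exp (-(p n * n * (1 - δ))) ≤
        Real.exp (-c) * Real.exp (-(α / 2 * (Real.log n + c))) := by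
      rw [← Real.exp_add]
      nth_rewrite 1 [← Real.exp_log hn0]
      rw [← Real.exp_add, Real.exp_le_exp]
      have := mul_le_mul_of_nonneg_right hn hδ3.le
      linear_combination this - (Real.log n + c) * hδ1
    rw [htdef]
    dsimp only
    linarith
  have hs' : Real.exp (-(p n * n * δ / 2)) ≤ Real.exp (-(α / 4 * (Real.log n + c))) := by
    rw [Real.exp_le_exp]
    linarith
  have hs : 2 * Real.exp (-(p n * n * δ / 2)) ≤ t n := by
    rw [htdef]
    dsimp only
    linarith
  have hd : (1 - p n) ^ n ≤ t n := by
    refine (pow_le_pow_left₀ (by linarith) hq n).trans ?_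
    rw [← Real.exp_nat_mul]
    have h1 : (n : ℝ) * -(p n * n / n) = -(p n * n) := by field_simp
    rw [h1]
    have h2 : Real.exp (-(p n * n)) ≤ Real.exp (-(p n * n * δ / 2)) := by
      rw [Real.exp_le_exp]
      nlinarith
    have : 0 < Real.exp (-(p n * n * δ / 2)) := by positivity
    linarith
  have hsum := sum_bound hL hδ (by linarith) hq ht2 hr hs
  refine le_trans (by linarith) (prob_lower (by omega : 0 < m) (hp n) _ ?_)
  intro M hM
  refine ⟨List.replicate (2 * n) ⟨0, by omega⟩, ?_, ?_, ?_⟩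
  · rw [Ne, List.replicate_eq_nil_iff]
    omega
  · rw [List.length_replicate]
    push_cast
    nlinarith
  · intro i j
    rw [List.map_replicate, List.prod_replicate]
    exact hM i j
end

section
/- Let m ≥ 2 be an integer, c ∈ ℝ, and p̂(n) = (log n + c)/n (considered for n large enough that p̂(n) ∈ [0,1]). Set a(m,c) = 1 − (1 − e^{−2e^{−c}})^m − m·e^{−2e^{−c}}·(1 − e^{−2e^{−c}})^{m−1}. Then a(m,c) ≤ liminf_{n→∞} P(B_m(n, p̂(n)) is primitive) and limsup_{n→∞} P(B_m(n, p̂(n)) is primitive) ≤ 1 − (1 − e^{−e^{−c}})^m. -/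
open Matrix Filter

/-- A set `{M 0, ..., M (m-1)}` of `n × n` matrices over `ℕ` is primitive if some nonempty
product of its elements (repetitions allowed) has all entries positive. -/
def IsPrimitive {n m : ℕ} (M : Fin m → Matrix (Fin n) (Fin n) ℕ) : Prop :=
  ∃ w : List (Fin m), w ≠ [] ∧ ∀ i j, 0 < (w.map M).prod i j

namespace Aux
open Finset

noncomputable def rowW {n : ℕ} (p : ℝ) (r : Fin n → Bool) : ℝ :=
  ∏ j, if r j then p else 1 - p

noncomputable def wt {n : ℕ} (p : ℝ) (b : Fin n → Fin n → Bool) : ℝ :=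
  ∏ i, rowW p (b i)

open Classical in
noncomputable def Pr (n : ℕ) (p : ℝ) (E : (Fin n → Fin n → Bool) → Prop) : ℝ :=
  ∑ b, if E b then wt p b else 0

open Classical in
noncomputable def PrR (n : ℕ) (p : ℝ) (E : (Fin n → Bool) → Prop) : ℝ :=
  ∑ r, if E r then rowW p r else 0

set_option linter.unusedVariables false in
lemma rowW_nonneg {n : ℕ} {p : ℝ} (h0 : 0 ≤ p) (h1 : p ≤ 1) (r : Fin n → Bool) :
    0 ≤ rowW p r := by
  unfold rowW
  refine Finset.prod_nonneg fun j _ => ?_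
  split_ifs <;> linarith

lemma wt_nonneg {n : ℕ} {p : ℝ} (h0 : 0 ≤ p) (h1 : p ≤ 1) (b : Fin n → Fin n → Bool) :
    0 ≤ wt p b := Finset.prod_nonneg fun i _ => rowW_nonneg h0 h1 _

lemma sum_rowW (n : ℕ) (p : ℝ) : ∑ r : Fin n → Bool, rowW p r = 1 := by
  unfold rowW
  rw [← Fintype.prod_sum (fun (_ : Fin n) (x : Bool) => if x then p else 1 - p)]
  simp

lemma sum_wt (n : ℕ) (p : ℝ) : ∑ b : Fin n → Fin n → Bool, wt p b = 1 := by
  unfold wt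
  rw [← Fintype.prod_sum (fun (_ : Fin n) (x : Fin n → Bool) => rowW p x)]
  simp [sum_rowW]

lemma Pr_mono {n : ℕ} {p : ℝ} (h0 : 0 ≤ p) (h1 : p ≤ 1) {E F : (Fin n → Fin n → Bool) → Prop}
    (h : ∀ b, E b → F b) : Pr n p E ≤ Pr n p F := by
  classical
  unfold Pr
  refine Finset.sum_le_sum fun b _ => ?_
  have := wt_nonneg h0 h1 b
  by_cases hE : E b
  · simp [hE, h b hE]
  · simp only [hE, if_false]; split_ifs <;> simp [this]

lemma Pr_nonneg {n : ℕ} {p : ℝ} (h0 : 0 ≤ p) (h1 : p ≤ 1) (E : (Fin n → Fin n → Bool) → Prop) :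
    0 ≤ Pr n p E := by
  refine Finset.sum_nonneg fun b _ => ?_
  have := wt_nonneg h0 h1 b
  split_ifs <;> simp [this]

lemma Pr_compl (n : ℕ) (p : ℝ) (E : (Fin n → Fin n → Bool) → Prop) :
    Pr n p (fun b => ¬ E b) = 1 - Pr n p E := by
  rw [eq_sub_iff_add_eq, ← sum_wt n p]
  unfold Pr
  rw [← Finset.sum_add_distrib]
  refine Finset.sum_congr rfl fun b _ => ?_
  by_cases h : E b <;> simp [h]

lemma Pr_le_one {n : ℕ} {p : ℝ} (h0 : 0 ≤ p) (h1 : p ≤ 1) (E : (Fin n → Fin n → Bool) → Prop) :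
    Pr n p E ≤ 1 := by
  have := Pr_compl n p E
  have := Pr_nonneg h0 h1 (fun b => ¬ E b)
  linarith

lemma Pr_or {n : ℕ} {p : ℝ} (h0 : 0 ≤ p) (h1 : p ≤ 1) (E F : (Fin n → Fin n → Bool) → Prop) :
    Pr n p (fun b => E b ∨ F b) ≤ Pr n p E + Pr n p F := by
  unfold Pr
  rw [← Finset.sum_add_distrib]
  refine Finset.sum_le_sum fun b _ => ?_
  have := wt_nonneg h0 h1 b
  by_cases hE : E b <;> by_cases hF : F b <;> simp [hE, hF, this]

lemma Pr_bUnion {n : ℕ} {p : ℝ} (h0 : 0 ≤ p) (h1 : p ≤ 1) {ι : Type*} (s : Finset ι)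
    (E : ι → (Fin n → Fin n → Bool) → Prop) :
    Pr n p (fun b => ∃ i ∈ s, E i b) ≤ ∑ i ∈ s, Pr n p (E i) := by
  classical
  unfold Pr
  rw [Finset.sum_comm]
  refine Finset.sum_le_sum fun b _ => ?_
  have := wt_nonneg h0 h1 b
  have hn : ∀ i ∈ s, 0 ≤ (if E i b then wt p b else 0) := by
    intro i _; split_ifs <;> simp [this]
  split_ifs with h
  · obtain ⟨i, hi, hE⟩ := h
    have := Finset.single_le_sum hn hi
    simpa [hE] using this
  · exact Finset.sum_nonneg hn

lemma PrR_bUnion {n : ℕ} {p : ℝ} (h0 : 0 ≤ p) (h1 : p ≤ 1) {ι : Type*} (s : Finset ι)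
    (E : ι → (Fin n → Bool) → Prop) :
    PrR n p (fun b => ∃ i ∈ s, E i b) ≤ ∑ i ∈ s, PrR n p (E i) := by
  classical
  unfold PrR
  rw [Finset.sum_comm]
  refine Finset.sum_le_sum fun b _ => ?_
  have := rowW_nonneg h0 h1 b
  have hn : ∀ i ∈ s, 0 ≤ (if E i b then rowW p b else 0) := by
    intro i _; split_ifs <;> simp [this]
  split_ifs with h
  · obtain ⟨i, hi, hE⟩ := h
    have := Finset.single_le_sum hn hi
    simpa [hE] using this
  · exact Finset.sum_nonneg hn

lemma Pr_rows (n : ℕ) (p : ℝ) (Q : Fin n → (Fin n → Bool) → Prop) :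
    Pr n p (fun b => ∀ i, Q i (b i)) = ∏ i, PrR n p (Q i) := by
  classical
  unfold Pr PrR
  rw [Fintype.prod_sum]
  refine Finset.sum_congr rfl fun b _ => ?_
  unfold wt
  by_cases h : ∀ i, Q i (b i)
  · simp [h]
  · rw [if_neg h]
    push Not at h
    obtain ⟨i, hi⟩ := h
    exact (Finset.prod_eq_zero (mem_univ i) (by simp [hi])).symm

/-- independent entries of a row -/
lemma PrR_entries (n : ℕ) (p : ℝ) (Q : Fin n → Bool → Prop) [∀ j x, Decidable (Q j x)] :
    PrR n p (fun r => ∀ j, Q j (r j)) =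
      ∏ j, ((if Q j true then p else 0) + (if Q j false then 1 - p else 0)) := by
  classical
  unfold PrR rowW
  have : ∀ j, ((if Q j true then p else 0) + (if Q j false then 1 - p else 0)) =
      ∑ x : Bool, if Q j x then (if x then p else 1 - p) else 0 := by
    intro j; simp
  simp_rw [this]
  rw [Fintype.prod_sum]
  refine Finset.sum_congr rfl fun b _ => ?_
  by_cases h : ∀ i, Q i (b i)
  · simp [h]
  · rw [if_neg h]
    push Not at h
    obtain ⟨i, hi⟩ := h
    exact (Finset.prod_eq_zero (mem_univ i) (by simp [hi])).symm

lemma PrR_true (n : ℕ) (p : ℝ) : PrR n p (fun _ => True) = 1 := by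
  simp [PrR, sum_rowW]

lemma PrR_compl (n : ℕ) (p : ℝ) (E : (Fin n → Bool) → Prop) :
    PrR n p (fun b => ¬ E b) = 1 - PrR n p E := by
  rw [eq_sub_iff_add_eq, ← sum_rowW n p]
  unfold PrR
  rw [← Finset.sum_add_distrib]
  refine Finset.sum_congr rfl fun b _ => ?_
  by_cases h : E b <;> simp [h]

lemma PrR_nonneg {n : ℕ} {p : ℝ} (h0 : 0 ≤ p) (h1 : p ≤ 1) (E : (Fin n → Bool) → Prop) :
    0 ≤ PrR n p E := by
  refine Finset.sum_nonneg fun b _ => ?_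
  have := rowW_nonneg h0 h1 b
  split_ifs <;> simp [this]

lemma PrR_nz (n : ℕ) (p : ℝ) : PrR n p (fun r => ∃ j, r j = true) = 1 - (1 - p) ^ n := by
  have h := PrR_compl n p (fun r => ∀ j, r j = false)
  rw [PrR_entries n p (fun _ x => x = false)] at h
  simpa using h

def NZR {n : ℕ} (b : Fin n → Fin n → Bool) : Prop := ∀ i, ∃ j, b i j = true

def tr {n : ℕ} (b : Fin n → Fin n → Bool) : Fin n → Fin n → Bool := fun i j => b j i

lemma Pr_NZR (n : ℕ) (p : ℝ) : Pr n p NZR = (1 - (1 - p) ^ n) ^ n := by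
  have := Pr_rows n p (fun _ r => ∃ j, r j = true)
  simp only [PrR_nz, Finset.prod_const, card_univ, Fintype.card_fin] at this
  exact this

lemma wt_tr {n : ℕ} (p : ℝ) (b : Fin n → Fin n → Bool) : wt p (tr b) = wt p b := by
  unfold wt rowW tr
  exact Finset.prod_comm

lemma Pr_tr (n : ℕ) (p : ℝ) (E : (Fin n → Fin n → Bool) → Prop) :
    Pr n p (fun b => E (tr b)) = Pr n p E := by
  unfold Pr
  refine Fintype.sum_equiv (Equiv.piComm _) _ _ fun b => ?_
  have : (Equiv.piComm (fun _ _ => Bool)) b = tr b := rfl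
  rw [this, wt_tr]

/-- closed set with nonzero rows -/
lemma Pr_closed {n : ℕ} {p : ℝ} (h0 : 0 ≤ p) (h1 : p ≤ 1) (S : Finset (Fin n)) :
    Pr n p (fun b => NZR b ∧ ∀ i ∈ S, ∀ j, j ∉ S → b i j = false) ≤
      (#S * (p * (1 - p) ^ (n - #S))) ^ #S := by
  classical
  have step : Pr n p (fun b => NZR b ∧ ∀ i ∈ S, ∀ j, j ∉ S → b i j = false) ≤
      Pr n p (fun b => ∀ i, (i ∈ S → ∃ j ∈ S, b i j = true ∧ ∀ k, k ∉ S → b i k = false)) := by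
    refine Pr_mono h0 h1 fun b ⟨hb, hc⟩ i hi => ?_
    obtain ⟨j, hj⟩ := hb i
    refine ⟨j, ?_, hj, hc i hi⟩
    by_contra hjS
    have := hc i hi j hjS
    simp_all
  refine step.trans ?_
  rw [Pr_rows n p (fun i r => (i ∈ S → ∃ j ∈ S, r j = true ∧ ∀ k, k ∉ S → r k = false))]
  have key : PrR n p (fun r => ∃ j ∈ S, r j = true ∧ ∀ k, k ∉ S → r k = false) ≤
      #S * (p * (1 - p) ^ (n - #S)) := by
    refine (PrR_bUnion h0 h1 S (fun j r => r j = true ∧ ∀ k, k ∉ S → r k = false)).trans ?_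
    rw [← nsmul_eq_mul]
    refine Finset.sum_le_card_nsmul _ _ _ fun j hj => ?_
    have e : (fun r : Fin n → Bool => r j = true ∧ ∀ k, k ∉ S → r k = false) =
        fun r => ∀ k, (k = j → r k = true) ∧ (k ∉ S → r k = false) := by
      funext r
      apply propext
      constructor
      · rintro ⟨a, b⟩ k
        exact ⟨fun h => h ▸ a, b k⟩
      · intro h
        exact ⟨(h j).1 rfl, fun k => (h k).2⟩
    rw [e, PrR_entries n p (fun k x => (k = j → x = true) ∧ (k ∉ S → x = false))]
    trans ∏ k, ((if k = j then p else 1) * (if k ∈ Sᶜ then 1 - p else 1))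
    · refine le_of_eq (Finset.prod_congr rfl fun k _ => ?_)
      by_cases hk : k = j
      · subst hk; simp [hj]
      · by_cases hS : k ∈ S <;> simp [hk, hS]
    rw [Finset.prod_mul_distrib, Finset.prod_ite_mem]
    simp [Finset.card_compl]
  have h2 : ∀ i, PrR n p (fun r => (i ∈ S → ∃ j ∈ S, r j = true ∧ ∀ k, k ∉ S → r k = false)) ≤
      if i ∈ S then (#S * (p * (1 - p) ^ (n - #S)) : ℝ) else 1 := by
    intro i
    by_cases hi : i ∈ S
    · simp only [hi, true_imp_iff, if_true]; exact key
    · simp [hi, PrR_true]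
  refine (Finset.prod_le_prod (fun i _ => PrR_nonneg h0 h1 _) fun i _ => h2 i).trans ?_
  simp [Finset.prod_ite_mem]

lemma log_modular {n : ℕ} (p : ℝ) (a b : Fin n → Fin n → Bool) :
    wt p a * wt p b = wt p (a ⊓ b) * wt p (a ⊔ b) := by
  unfold wt rowW
  simp_rw [← Finset.prod_mul_distrib]
  refine Finset.prod_congr rfl fun i _ => Finset.prod_congr rfl fun j _ => ?_
  have h : ∀ x y : Bool, ((if x = true then p else 1 - p) * if y = true then p else 1 - p) =
      (if (x ⊓ y) = true then p else 1 - p) * if (x ⊔ y) = true then p else 1 - p := by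
    intro x y
    cases x <;> cases y <;> simp <;> ring
  exact h (a i j) (b i j)

lemma harris {n : ℕ} {p : ℝ} (h0 : 0 ≤ p) (h1 : p ≤ 1) (E F : (Fin n → Fin n → Bool) → Prop)
    (hE : ∀ a b, a ≤ b → E a → E b) (hF : ∀ a b, a ≤ b → F a → F b) :
    Pr n p E * Pr n p F ≤ Pr n p (fun b => E b ∧ F b) := by
  classical
  have mono : ∀ G : (Fin n → Fin n → Bool) → Prop, (∀ a b, a ≤ b → G a → G b) →
      Monotone (fun b => if G b then (1 : ℝ) else 0) := by
    intro G hG a b hab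
    by_cases h : G a
    · simp [h, hG a b hab h]
    · simp only [h, if_false]; split_ifs <;> simp
  have nn : ∀ G : (Fin n → Fin n → Bool) → Prop,
      0 ≤ (fun b => if G b then (1 : ℝ) else 0) := by
    intro G a
    simp only [Pi.zero_apply]
    split_ifs <;> simp
  have := fkg (fun b => if E b then (1 : ℝ) else 0) (fun b => if F b then (1 : ℝ) else 0)
    (wt p) (fun b => wt_nonneg h0 h1 b) (nn E) (nn F) (mono E hE) (mono F hF)
    (fun a b => (log_modular p a b).le)
  rw [sum_wt, one_mul] at this
  have c1 : ∀ G : (Fin n → Fin n → Bool) → Prop,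
      Pr n p G = ∑ a, wt p a * if G a then (1 : ℝ) else 0 := by
    intro G
    unfold Pr
    refine Finset.sum_congr rfl fun b _ => ?_
    by_cases h : G b <;> simp [h]
  rw [c1, c1, c1]
  refine this.trans (le_of_eq (Finset.sum_congr rfl fun b _ => ?_))
  by_cases h : E b <;> by_cases h' : F b <;> simp [h, h']

lemma Pr_NZ {n : ℕ} {p : ℝ} (h0 : 0 ≤ p) (h1 : p ≤ 1) :
    ((1 - (1 - p) ^ n) ^ n) ^ 2 ≤ Pr n p (fun b => NZR b ∧ NZR (tr b)) := by
  have := harris (n := n) h0 h1 NZR (fun b => NZR (tr b)) ?_ ?_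
  · rw [Pr_tr, Pr_NZR] at this
    rwa [sq]
  · intro a b hab h i
    obtain ⟨j, hj⟩ := h i
    refine ⟨j, ?_⟩
    have := hab i j
    rw [hj] at this
    exact top_le_iff.mp this
  · intro a b hab h i
    obtain ⟨j, hj⟩ := h i
    refine ⟨j, ?_⟩
    have := hab j i
    simp only [tr] at hj ⊢
    rw [hj] at this
    exact top_le_iff.mp this

lemma Pr_noloop {n : ℕ} (p : ℝ) : Pr n p (fun b => ∀ i, b i i = false) = (1 - p) ^ n := by
  rw [Pr_rows n p (fun i r => r i = false)]
  have : ∀ i : Fin n, PrR n p (fun r => r i = false) = 1 - p := by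
    intro i
    have e : (fun r : Fin n → Bool => r i = false) = fun r => ∀ k, k = i → r k = false := by
      funext r; simp
    rw [e, PrR_entries n p (fun k x => k = i → x = false)]
    trans ∏ k, (if k = i then 1 - p else 1)
    · refine Finset.prod_congr rfl fun k _ => ?_
      by_cases h : k = i <;> simp [h]
    · simp
  simp [this]

/-- deterministic part -/
lemma primitive_of {n : ℕ} (A : Matrix (Fin n) (Fin n) ℕ) (v : Fin n) (hv : 0 < A v v)
    (hA : ∀ S : Finset (Fin n), S.Nonempty → S ≠ univ → ∃ i ∈ S, ∃ j, j ∉ S ∧ 0 < A i j) :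
    ∃ N : ℕ, N ≠ 0 ∧ ∀ i j, 0 < (A ^ N) i j := by
  classical
  have mulpos : ∀ (B C : Matrix (Fin n) (Fin n) ℕ) i j k, 0 < B i j → 0 < C j k →
      0 < (B * C) i k := by
    intro B C i j k hB hC
    rw [Matrix.mul_apply]
    exact Finset.sum_pos' (fun _ _ => Nat.zero_le _) ⟨j, mem_univ _, Nat.mul_pos hB hC⟩
  have vpow : ∀ t, 0 < (A ^ t) v v := by
    intro t
    induction t with
    | zero => simp
    | succ t ih => rw [pow_succ]; exact mulpos _ _ _ _ _ ih hv
  have reach : ∀ j, ∃ t, 0 < (A ^ t) v j := by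
    by_contra hcon
    push Not at hcon
    obtain ⟨j0, hj0⟩ := hcon
    obtain ⟨i, hi, j, hj, hij⟩ := hA (univ.filter fun j => ∃ t, 0 < (A ^ t) v j)
      ⟨v, by simpa using ⟨0, vpow 0⟩⟩ (by
        intro h
        have : j0 ∈ (univ.filter fun j => ∃ t, 0 < (A ^ t) v j) := by rw [h]; exact mem_univ _
        simp only [mem_filter, mem_univ, true_and] at this
        obtain ⟨t, ht⟩ := this
        exact absurd (hj0 t) (by omega))
    simp only [mem_filter, mem_univ, true_and] at hi hj
    obtain ⟨t, ht⟩ := hi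
    exact hj ⟨t + 1, by rw [pow_succ]; exact mulpos _ _ _ _ _ ht hij⟩
  have reach' : ∀ i, ∃ t, 0 < (A ^ t) i v := by
    by_contra hcon
    push Not at hcon
    obtain ⟨i0, hi0⟩ := hcon
    obtain ⟨i, hi, j, hj, hij⟩ := hA (univ.filter fun i => ¬ ∃ t, 0 < (A ^ t) i v)
      ⟨i0, by
        simp only [mem_filter, mem_univ, true_and]
        rintro ⟨t, ht⟩
        exact absurd (hi0 t) (by omega)⟩ (by
        intro h
        have : v ∈ (univ.filter fun i => ¬ ∃ t, 0 < (A ^ t) i v) := by rw [h]; exact mem_univ _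
        simp only [mem_filter, mem_univ, true_and] at this
        exact this ⟨0, vpow 0⟩)
    simp only [mem_filter, mem_univ, true_and, not_not] at hi hj
    obtain ⟨t, ht⟩ := hj
    exact hi ⟨t + 1, by rw [pow_succ']; exact mulpos _ _ _ _ _ hij ht⟩
  choose f hf using reach
  choose g hg using reach'
  refine ⟨(∑ i, g i) + (∑ j, f j) + 1, by omega, fun i j => ?_⟩
  have h1 : g i ≤ ∑ i, g i := Finset.single_le_sum (f := g) (fun _ _ => Nat.zero_le _) (mem_univ i)
  have h2 : f j ≤ ∑ j, f j := Finset.single_le_sum (f := f) (fun _ _ => Nat.zero_le _) (mem_univ j)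
  obtain ⟨u, hu⟩ : ∃ u, (∑ i, g i) + (∑ j, f j) + 1 = g i + (u + f j) :=
    ⟨(∑ i, g i) + (∑ j, f j) + 1 - g i - f j, by omega⟩
  rw [hu, pow_add, pow_add]
  exact mulpos _ _ _ _ _ (hg i) (mulpos _ _ _ _ _ (vpow u) (hf j))

def Good {n : ℕ} (b : Fin n → Fin n → Bool) : Prop :=
  (∃ v, b v v = true) ∧ ∀ S : Finset (Fin n), S.Nonempty → S ≠ univ →
    ∃ i ∈ S, ∃ j, j ∉ S ∧ b i j = true

lemma isPrimitive_of_good {n m : ℕ} (b : Fin m → Fin n → Fin n → Bool) (k : Fin m)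
    (h : Good (b k)) : _root_.IsPrimitive (fun k => toMat (b k)) := by
  obtain ⟨⟨v, hv⟩, hS⟩ := h
  obtain ⟨N, hN, hpos⟩ := primitive_of (toMat (b k)) v (by simp [toMat, hv]) (by
    intro S h1 h2
    obtain ⟨i, hi, j, hj, hij⟩ := hS S h1 h2
    exact ⟨i, hi, j, hj, by simp [toMat, hij]⟩)
  refine ⟨List.replicate N k, by simpa using hN, ?_⟩
  simpa using hpos

def smallSets (n : ℕ) : Finset (Finset (Fin n)) := univ.filter fun S => S.Nonempty ∧ 2 * #S ≤ n

def BadAt {n : ℕ} (S : Finset (Fin n)) (b : Fin n → Fin n → Bool) : Prop :=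
  NZR b ∧ ∀ i ∈ S, ∀ j, j ∉ S → b i j = false

lemma good_or {n : ℕ} (b : Fin n → Fin n → Bool) (h : NZR b ∧ NZR (tr b)) :
    Good b ∨ ((∀ i, b i i = false) ∨ ((∃ S ∈ smallSets n, BadAt S b) ∨
      ∃ S ∈ smallSets n, BadAt S (tr b))) := by
  classical
  by_contra hcon
  push Not at hcon
  obtain ⟨hg, ⟨v, hv⟩, h1, h2⟩ := hcon
  apply hg
  refine ⟨⟨v, by simpa using hv⟩, fun S hS hSu => ?_⟩
  by_contra hno
  push Not at hno
  by_cases hc : 2 * #S ≤ n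
  · exact h1 S (by simp [smallSets, hS, hc]) ⟨h.1, fun i hi j hj => by simpa using hno i hi j hj⟩
  · refine h2 Sᶜ ?_ ⟨h.2, fun i hi j hj => ?_⟩
    · simp only [smallSets, mem_filter, mem_univ, true_and, card_compl, Fintype.card_fin]
      refine ⟨?_, by omega⟩
      rw [Finset.nonempty_iff_ne_empty]
      simpa using hSu
    · simp only [mem_compl, not_not] at hi hj
      simpa [tr] using hno j hj i hi

lemma Pr_good {n : ℕ} {p : ℝ} (h0 : 0 ≤ p) (h1 : p ≤ 1) :
    ((1 - (1 - p) ^ n) ^ n) ^ 2 - (1 - p) ^ n -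
      2 * ∑ S ∈ smallSets n, ((#S : ℝ) * (p * (1 - p) ^ (n - #S))) ^ #S ≤ Pr n p Good := by
  have a1 := Pr_NZ (n := n) h0 h1
  have a2 := Pr_mono (n := n) h0 h1 good_or
  have a3 := Pr_or (n := n) h0 h1 Good (fun b => (∀ i, b i i = false) ∨
    ((∃ S ∈ smallSets n, BadAt S b) ∨ ∃ S ∈ smallSets n, BadAt S (tr b)))
  have a4 := Pr_or (n := n) h0 h1 (fun b => ∀ i, b i i = false)
    (fun b => (∃ S ∈ smallSets n, BadAt S b) ∨ ∃ S ∈ smallSets n, BadAt S (tr b))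
  have a5 := Pr_or (n := n) h0 h1 (fun b => ∃ S ∈ smallSets n, BadAt S b)
    (fun b => ∃ S ∈ smallSets n, BadAt S (tr b))
  rw [Pr_noloop] at a4
  rw [Pr_tr n p (fun b => ∃ S ∈ smallSets n, BadAt S b)] at a5
  have a6 := Pr_bUnion (n := n) h0 h1 (smallSets n) BadAt
  have a7 := Finset.sum_le_sum (s := smallSets n) fun S _ => Pr_closed (n := n) h0 h1 S
  have a8 : ∑ S ∈ smallSets n, Pr n p (BadAt S) ≤
    ∑ S ∈ smallSets n, ((#S : ℝ) * (p * (1 - p) ^ (n - #S))) ^ #S := a7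
  linarith

/-- passing from one matrix to `m` -/
lemma bern_lower {n m : ℕ} {p : ℝ} (h0 : 0 ≤ p) (h1 : p ≤ 1) :
    1 - (1 - Pr n p Good) ^ m ≤ bernoulliProb n m p (fun M => _root_.IsPrimitive M) := by
  classical
  rw [← Pr_compl]
  have t : ∑ b : Fin m → Fin n → Fin n → Bool, ∏ k, wt p (b k) = 1 := by
    rw [← Fintype.sum_pow, sum_wt, one_pow]
  have e : Pr n p (fun b => ¬ Good b) ^ m = ∑ b : Fin m → Fin n → Fin n → Bool,
      ∏ k, if ¬ Good (b k) then wt p (b k) else 0 := by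
    unfold Pr; rw [Fintype.sum_pow]; congr!
  rw [e, ← t, ← Finset.sum_sub_distrib]
  unfold bernoulliProb
  refine Finset.sum_le_sum fun b _ => ?_
  have nn : 0 ≤ ∏ k, wt p (b k) := Finset.prod_nonneg fun k _ => wt_nonneg h0 h1 _
  by_cases h : ∃ k, Good (b k)
  · obtain ⟨k, hk⟩ := h
    have z : (∏ k, if ¬ Good (b k) then wt p (b k) else 0) = 0 :=
      Finset.prod_eq_zero (i := k) (mem_univ _) (by simp [hk])
    rw [if_pos (isPrimitive_of_good b k hk), z]
    simp [wt, rowW]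
  · push Not at h
    simp only [h, not_false_eq_true, if_true, sub_self]
    split_ifs
    · exact nn
    · simp

lemma bern_upper {n m : ℕ} {p : ℝ} (h0 : 0 ≤ p) (h1 : p ≤ 1) (hn : 0 < n) :
    bernoulliProb n m p (fun M => _root_.IsPrimitive M) ≤ 1 - (1 - (1 - (1 - p) ^ n) ^ n) ^ m := by
  classical
  rw [← Pr_NZR, ← Pr_compl]
  have t : ∑ b : Fin m → Fin n → Fin n → Bool, ∏ k, wt p (b k) = 1 := by
    rw [← Fintype.sum_pow, sum_wt, one_pow]
  have e : Pr n p (fun b => ¬ NZR b) ^ m = ∑ b : Fin m → Fin n → Fin n → Bool,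
      ∏ k, if ¬ NZR (b k) then wt p (b k) else 0 := by
    unfold Pr; rw [Fintype.sum_pow]; congr!
  rw [e, ← t, ← Finset.sum_sub_distrib]
  unfold bernoulliProb
  refine Finset.sum_le_sum fun b _ => ?_
  have nn : 0 ≤ ∏ k, wt p (b k) := Finset.prod_nonneg fun k _ => wt_nonneg h0 h1 _
  by_cases h : ∃ k, NZR (b k)
  · obtain ⟨k, hk⟩ := h
    have z : (∏ k, if ¬ NZR (b k) then wt p (b k) else 0) = 0 :=
      Finset.prod_eq_zero (i := k) (mem_univ _) (by simp [hk])
    rw [z, sub_zero]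
    split_ifs
    · simp [wt, rowW]
    · exact nn
  · push Not at h
    have hp : ¬ _root_.IsPrimitive (fun k => toMat (b k)) := by
      rintro ⟨w, hw, hpos⟩
      cases w with
      | nil => exact hw rfl
      | cons k w =>
        have hk := h k
        unfold NZR at hk
        push Not at hk
        obtain ⟨i, hi⟩ := hk
        have := hpos i ⟨0, hn⟩
        rw [List.map_cons, List.prod_cons, Matrix.mul_apply] at this
        rw [Finset.sum_eq_zero] at this
        · exact absurd this (lt_irrefl _)
        · intro j _
          simp [toMat, hi j]
    simp only [h, not_false_eq_true, if_true, sub_self]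
    rw [if_neg hp]

lemma sum_small {n : ℕ} {p : ℝ} (h0 : 0 ≤ p) (h1 : p ≤ 1)
    (hx : Real.exp 1 * (n * p * Real.exp (-(n * p / 2))) ≤ 1 / 2) :
    ∑ S ∈ smallSets n, ((#S : ℝ) * (p * (1 - p) ^ (n - #S))) ^ #S ≤
      2 * (Real.exp 1 * (n * p * Real.exp (-(n * p / 2)))) := by
  classical
  set y : ℝ := p * Real.exp (-(n * p / 2)) with hy
  have hy0 : 0 ≤ y := by positivity
  set x : ℝ := Real.exp 1 * (n * p * Real.exp (-(n * p / 2))) with hxd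
  have hx0 : 0 ≤ x := by positivity
  have hxy : x = Real.exp 1 * n * y := by rw [hxd, hy]; ring
  let G : ℕ → ℝ := fun k => if k = 0 then 0 else ((k : ℝ) * y) ^ k
  have hG0 : ∀ k, 0 ≤ G k := by
    intro k; simp only [G]; split_ifs
    · simp
    · positivity
  have s1 : ∑ S ∈ smallSets n, ((#S : ℝ) * (p * (1 - p) ^ (n - #S))) ^ #S ≤
      ∑ S ∈ smallSets n, G #S := by
    refine Finset.sum_le_sum fun S hS => ?_
    simp only [smallSets, mem_filter, mem_univ, true_and] at hS
    have hne : #S ≠ 0 := by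
      have := hS.1.card_pos; omega
    simp only [G, hne, if_false]
    have hb : 0 ≤ 1 - p := by linarith
    gcongr
    rw [hy]
    gcongr
    have e1 : (1 - p) ≤ Real.exp (-p) := by
      have := Real.add_one_le_exp (-p); linarith
    calc (1 - p) ^ (n - #S) ≤ (Real.exp (-p)) ^ (n - #S) := by gcongr
      _ = Real.exp (-(((n - #S : ℕ) : ℝ) * p)) := by
        rw [← Real.exp_nat_mul]; ring_nf
      _ ≤ _ := by
        apply Real.exp_le_exp.mpr
        have h2 : (n : ℝ) ≤ 2 * ((n - #S : ℕ) : ℝ) := by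
          exact_mod_cast (by omega : n ≤ 2 * (n - #S))
        nlinarith
  have s2 : ∑ S ∈ smallSets n, G #S ≤ ∑ S ∈ (univ : Finset (Fin n)).powerset, G #S := by
    refine Finset.sum_le_sum_of_subset_of_nonneg (fun S _ => by simp) fun S _ _ => hG0 _
  rw [Finset.sum_powerset_apply_card] at s2
  have s3 : ∀ k, (((#(univ : Finset (Fin n))).choose k) • G k : ℝ) ≤ if k = 0 then 0 else x ^ k := by
    intro k
    simp only [G]
    split_ifs with hk
    · simp
    · rw [nsmul_eq_mul, card_univ, Fintype.card_fin]
      have c1 : ((n.choose k : ℕ) : ℝ) ≤ (n : ℝ) ^ k / k.factorial := Nat.choose_le_pow_div k n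
      have c2 := Real.pow_div_factorial_le_exp (k : ℝ) (by positivity) k
      calc ((n.choose k : ℕ) : ℝ) * ((k : ℝ) * y) ^ k
          ≤ ((n : ℝ) ^ k / k.factorial) * ((k : ℝ) * y) ^ k := by gcongr
        _ = ((k : ℝ) ^ k / k.factorial) * ((n : ℝ) * y) ^ k := by
          rw [mul_pow, mul_pow]; ring
        _ ≤ Real.exp k * ((n : ℝ) * y) ^ k := by gcongr
        _ = x ^ k := by
          rw [hxy, mul_assoc, mul_pow (Real.exp 1), ← Real.exp_nat_mul, mul_one]
  have s4 : ∀ N : ℕ, ∑ k ∈ range (N + 1), (if k = 0 then 0 else x ^ k) ≤ 2 * x := by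
    intro N
    rw [Finset.sum_range_succ']
    simp only [Nat.add_eq_zero_iff, one_ne_zero, and_false, if_false, if_true, add_zero]
    have : ∑ k ∈ range N, x ^ k ≤ 2 := by
      have hlt : x < 1 := by linarith
      have := (summable_geometric_of_lt_one hx0 hlt).sum_le_tsum (range N) (fun _ _ => by positivity)
      rw [tsum_geometric_of_lt_one hx0 hlt] at this
      refine this.trans ?_
      rw [inv_le_comm₀ (by linarith) (by norm_num)]
      linarith
    calc ∑ k ∈ range N, x ^ (k + 1) = (∑ k ∈ range N, x ^ k) * x := by
          rw [Finset.sum_mul]; simp_rw [pow_succ]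
      _ ≤ 2 * x := by gcongr
  exact s1.trans (s2.trans ((Finset.sum_le_sum fun k _ => s3 k).trans (s4 _)))

open Topology

section lim
variable (c : ℝ)

noncomputable def ph (n : ℕ) : ℝ := (Real.log n + c) / n

lemma t_top : Tendsto (fun n : ℕ => Real.log n + c) atTop atTop :=
  tendsto_atTop_add_const_right _ _ (Real.tendsto_log_atTop.comp tendsto_natCast_atTop_atTop)

lemma n_eq {n : ℕ} (hn : 0 < n) : (n : ℝ)⁻¹ = Real.exp (-(Real.log n + c)) * Real.exp c := by
  rw [← Real.exp_add]
  have : (0 : ℝ) < n := by exact_mod_cast hn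
  rw [show -(Real.log n + c) + c = -Real.log n by ring, Real.exp_neg, Real.exp_log this]

lemma ph_tend (k : ℕ) : Tendsto (fun n : ℕ => (Real.log n + c) ^ k / n) atTop (𝓝 0) := by
  have h := ((Real.tendsto_pow_mul_exp_neg_atTop_nhds_zero k).comp (t_top c)).mul_const (Real.exp c)
  rw [zero_mul] at h
  refine h.congr' ?_
  filter_upwards [eventually_gt_atTop 0] with n hn
  rw [div_eq_mul_inv, n_eq c hn]
  simp only [Function.comp]
  ring

lemma ph_lim : Tendsto (ph c) atTop (𝓝 0) := by
  have h := ph_tend c 1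
  simp only [pow_one] at h
  exact h

lemma ph_mul {n : ℕ} (hn : 0 < n) : (n : ℝ) * ph c n = Real.log n + c := by
  have : (n : ℝ) ≠ 0 := by positivity
  unfold ph; field_simp

lemma ph_bounds : ∀ᶠ n in atTop, 0 ≤ ph c n ∧ ph c n ≤ 1 := by
  filter_upwards [(t_top c).eventually_ge_atTop 0,
    (ph_lim c).eventually_le_const (show (0 : ℝ) < 1 by norm_num)] with n h1 h2
  exact ⟨div_nonneg h1 (by positivity), h2⟩

lemma lim1 : Tendsto (fun n : ℕ => (n : ℝ) * (1 - ph c n) ^ n) atTop (𝓝 (Real.exp (-c))) := by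
  have hl : Tendsto (fun n : ℕ => Real.exp (-c) * (1 - (Real.log n + c) ^ 2 / n)) atTop
      (𝓝 (Real.exp (-c))) := by
    simpa using ((ph_tend c 2).const_sub 1).const_mul (Real.exp (-c))
  have key : ∀ n : ℕ, 0 < n → (n : ℝ) * Real.exp (-ph c n) ^ n = Real.exp (-c) := by
    intro n hn
    have : (0 : ℝ) < n := by exact_mod_cast hn
    rw [← Real.exp_nat_mul, mul_neg, ph_mul c hn, neg_add, Real.exp_add, Real.exp_neg (Real.log n),
      Real.exp_log this]
    field_simp
  refine tendsto_of_tendsto_of_tendsto_of_le_of_le' hl tendsto_const_nhds ?_ ?_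
  · filter_upwards [ph_bounds c, eventually_gt_atTop 0] with n ⟨h0, h1⟩ hn
    have hn' : (0 : ℝ) < n := by exact_mod_cast hn
    rw [← key n hn]
    have e1 : Real.exp (-ph c n) * (1 - ph c n ^ 2) ≤ 1 - ph c n := by
      have a := Real.add_one_le_exp (ph c n)
      have b : Real.exp (-ph c n) * Real.exp (ph c n) = 1 := by
        rw [← Real.exp_add]; simp
      have d : Real.exp (-ph c n) * (1 + ph c n) ≤ 1 := by
        rw [← b]; gcongr; linarith
      nlinarith
    have e2 : 1 - (Real.log n + c) ^ 2 / n ≤ (1 - ph c n ^ 2) ^ n := by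
      have := one_add_mul_le_pow (a := -(ph c n ^ 2)) (by nlinarith) n
      have e : (Real.log n + c) ^ 2 / n = n * ph c n ^ 2 := by
        unfold ph; field_simp
      rw [e]
      have f : 1 - ph c n ^ 2 = 1 + -(ph c n ^ 2) := by ring
      rw [f]; linarith
    calc (n : ℝ) * Real.exp (-ph c n) ^ n * (1 - (Real.log n + c) ^ 2 / n)
        ≤ (n : ℝ) * Real.exp (-ph c n) ^ n * (1 - ph c n ^ 2) ^ n := by gcongr
      _ = n * (Real.exp (-ph c n) * (1 - ph c n ^ 2)) ^ n := by rw [mul_pow]; ring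
      _ ≤ _ := by
        have : 0 ≤ 1 - ph c n ^ 2 := by nlinarith
        gcongr
  · filter_upwards [ph_bounds c, eventually_gt_atTop 0] with n ⟨h0, h1⟩ hn
    rw [← key n hn]
    have : 0 ≤ 1 - ph c n := by linarith
    gcongr
    have := Real.add_one_le_exp (-ph c n); linarith

lemma lim_q : Tendsto (fun n : ℕ => (1 - (1 - ph c n) ^ n) ^ n) atTop
    (𝓝 (Real.exp (-Real.exp (-c)))) := by
  have := Real.tendsto_one_add_pow_exp_of_tendsto (g := fun n => -(1 - ph c n) ^ n)
    (t := -Real.exp (-c)) (by simpa using (lim1 c).neg)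
  simpa [sub_eq_add_neg] using this

lemma lim_loop : Tendsto (fun n : ℕ => (1 - ph c n) ^ n) atTop (𝓝 0) := by
  have := (lim1 c).mul tendsto_inv_atTop_nhds_zero_nat
  rw [mul_zero] at this
  refine this.congr' ?_
  filter_upwards [eventually_gt_atTop 0] with n hn
  have hn' : (n : ℝ) ≠ 0 := by positivity
  field_simp

lemma lim_x : Tendsto (fun n : ℕ => Real.exp 1 * (n * ph c n * Real.exp (-(n * ph c n / 2))))
    atTop (𝓝 0) := by
  have h := ((Real.tendsto_pow_mul_exp_neg_atTop_nhds_zero 1).comp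
    ((t_top c).atTop_div_const (show (0 : ℝ) < 2 by norm_num))).const_mul (2 * Real.exp 1)
  rw [mul_zero] at h
  refine h.congr' ?_
  filter_upwards [eventually_gt_atTop 0] with n hn
  rw [ph_mul c hn]
  simp only [Function.comp]
  ring

end lim

lemma lower_ev (c : ℝ) (m : ℕ) : ∃ L : ℕ → ℝ,
    Tendsto L atTop (𝓝 (1 - (1 - Real.exp (-2 * Real.exp (-c))) ^ m)) ∧
    ∀ᶠ n in atTop, L n ≤ bernoulliProb n m (ph c n) (fun M => _root_.IsPrimitive M) := by
  refine ⟨fun n => 1 - (1 - (((1 - (1 - ph c n) ^ n) ^ n) ^ 2 - (1 - ph c n) ^ n -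
      2 * (2 * (Real.exp 1 * (n * ph c n * Real.exp (-(n * ph c n / 2))))))) ^ m, ?_, ?_⟩
  · have h := ((((lim_q c).pow 2).sub (lim_loop c)).sub (((lim_x c).const_mul 2).const_mul 2))
    have h2 := ((h.const_sub 1).pow m).const_sub 1
    convert h2 using 5
    rw [← Real.exp_nat_mul]
    simp
  · filter_upwards [ph_bounds c,
      (lim_x c).eventually_le_const (show (0 : ℝ) < 1 / 2 by norm_num)] with n ⟨h0, h1⟩ hx
    refine le_trans ?_ (bern_lower h0 h1)
    have a := Pr_good (n := n) h0 h1
    have b := sum_small (n := n) h0 h1 hx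
    have d := Pr_le_one (n := n) h0 h1 Good
    have : 0 ≤ 1 - Pr n (ph c n) Good := by linarith
    gcongr
    linarith

end Aux

/-- Let `m ≥ 2`, `c ∈ ℝ` and `p̂ n = (log n + c)/n`.  With
`a(m,c) = 1 − (1 − e^{−2e^{−c}})^m − m·e^{−2e^{−c}}·(1 − e^{−2e^{−c}})^{m−1}`, one has
`a(m,c) ≤ liminf P(B_m(n, p̂ n) primitive)` and
`limsup P(B_m(n, p̂ n) primitive) ≤ 1 − (1 − e^{−e^{−c}})^m`. -/
theorem stmt4 (m : ℕ) (hm : 2 ≤ m) (c : ℝ) :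
    1 - (1 - Real.exp (-2 * Real.exp (-c))) ^ m -
        m * Real.exp (-2 * Real.exp (-c)) *
          (1 - Real.exp (-2 * Real.exp (-c))) ^ (m - 1) ≤
      liminf (fun n : ℕ =>
        bernoulliProb n m ((Real.log n + c) / n) (fun M => IsPrimitive M)) atTop ∧
    limsup (fun n : ℕ =>
        bernoulliProb n m ((Real.log n + c) / n) (fun M => IsPrimitive M)) atTop ≤
      1 - (1 - Real.exp (-Real.exp (-c))) ^ m := by
  obtain ⟨L, hL, hLle⟩ := Aux.lower_ev c m
  have hU : Tendsto (fun n : ℕ => 1 - (1 - (1 - (1 - Aux.ph c n) ^ n) ^ n) ^ m) atTop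
      (nhds (1 - (1 - Real.exp (-Real.exp (-c))) ^ m)) :=
    (((Aux.lim_q c).const_sub 1).pow m).const_sub 1
  have hUle : ∀ᶠ n in atTop, bernoulliProb n m (Aux.ph c n) (fun M => _root_.IsPrimitive M) ≤
      1 - (1 - (1 - (1 - Aux.ph c n) ^ n) ^ n) ^ m := by
    filter_upwards [Aux.ph_bounds c, eventually_gt_atTop 0] with n ⟨h0, h1⟩ hn
    exact Aux.bern_upper h0 h1 hn
  have bA : IsBoundedUnder (· ≤ ·) atTop
      (fun n => bernoulliProb n m (Aux.ph c n) (fun M => _root_.IsPrimitive M)) :=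
    hU.isBoundedUnder_le.mono_le hUle
  have bB : IsBoundedUnder (· ≥ ·) atTop
      (fun n => bernoulliProb n m (Aux.ph c n) (fun M => _root_.IsPrimitive M)) :=
    hL.isBoundedUnder_ge.mono_ge hLle
  constructor
  · have h := liminf_le_liminf hLle hL.isBoundedUnder_ge bA.isCoboundedUnder_ge
    rw [hL.liminf_eq] at h
    refine le_trans ?_ h
    have e0 : 0 ≤ Real.exp (-2 * Real.exp (-c)) := (Real.exp_pos _).le
    have e1 : Real.exp (-2 * Real.exp (-c)) ≤ 1 := by
      apply Real.exp_le_one_iff.mpr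
      have := Real.exp_pos (-c)
      linarith
    have : 0 ≤ (m : ℝ) * Real.exp (-2 * Real.exp (-c)) *
          (1 - Real.exp (-2 * Real.exp (-c))) ^ (m - 1) := by
      have : 0 ≤ 1 - Real.exp (-2 * Real.exp (-c)) := by linarith
      positivity
    linarith
  · have h := limsup_le_limsup hUle bB.isCoboundedUnder_le hU.isBoundedUnder_le
    rw [hU.limsup_eq] at h
    exact h
end

section
/- Let m ≥ 2 be an integer, c ∈ ℝ, and p̂(n) = (log n + c)/n (considered for n large enough that p̂(n) ∈ [0,1]). Set a(m,c) = 1 − (1 − e^{−2e^{−c}})^m − m·e^{−2e^{−c}}·(1 − e^{−2e^{−c}})^{m−1}. Then a(m,c) ≤ liminf_{n→∞} P(B_m(n, p̂(n)) is 3-directable) and limsup_{n→∞} P(B_m(n, p̂(n)) is 3-directable) ≤ 1 − (1 − e^{−e^{−c}})^m. -/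
open Matrix Filter

/-- The set `M` is 3-directable: some nonempty product of its elements has an entrywise
positive column. -/
def Is3Directable {n m : ℕ} (M : Fin m → Matrix (Fin n) (Fin n) ℕ) : Prop :=
  ∃ w : List (Fin m), w ≠ [] ∧ ∃ j, ∀ i, 0 < (w.map M).prod i j

section helpers

open Classical in
noncomputable def Pw {α : Type*} [Fintype α] (w : α → ℝ) (E : α → Prop) : ℝ :=
  ∑ a, if E a then w a else 0

variable {α : Type*} [Fintype α] {w : α → ℝ} {E F : α → Prop}

lemma Pw_mono (hw : ∀ a, 0 ≤ w a) (h : ∀ a, E a → F a) : Pw w E ≤ Pw w F := by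
  classical
  unfold Pw
  refine Finset.sum_le_sum fun a _ => ?_
  by_cases h1 : E a
  · simp [h1, h a h1]
  · by_cases h2 : F a <;> simp [h1, h2, hw a]

lemma Pw_nonneg (hw : ∀ a, 0 ≤ w a) : 0 ≤ Pw w E := by
  classical
  unfold Pw
  refine Finset.sum_nonneg fun a _ => ?_
  split_ifs <;> simp [hw a]

lemma Pw_or (hw : ∀ a, 0 ≤ w a) : Pw w (fun a => E a ∨ F a) ≤ Pw w E + Pw w F := by
  classical
  unfold Pw
  rw [← Finset.sum_add_distrib]
  refine Finset.sum_le_sum fun a _ => ?_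
  by_cases h1 : E a <;> by_cases h2 : F a <;> simp [h1, h2, hw a]

lemma Pw_biUnion {ι : Type*} (hw : ∀ a, 0 ≤ w a) (s : Finset ι) (G : ι → α → Prop) :
    Pw w (fun a => ∃ i ∈ s, G i a) ≤ ∑ i ∈ s, Pw w (G i) := by
  classical
  induction s using Finset.induction_on with
  | empty => simp [Pw]
  | insert x s hx ih =>
    rw [Finset.sum_insert hx]
    refine le_trans (Pw_mono hw (F := fun a => G x a ∨ ∃ i ∈ s, G i a) ?_) ?_
    · intro a; simp
    · exact (Pw_or hw).trans (by gcongr)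

lemma Pw_compl : Pw w (fun a => ¬ E a) = Pw w (fun _ => True) - Pw w E := by
  classical
  unfold Pw
  rw [← Finset.sum_sub_distrib]
  refine Finset.sum_congr rfl fun a _ => ?_
  by_cases h1 : E a <;> simp [h1]

lemma Pw_pi {ι : Type*} [Fintype ι] [DecidableEq ι] (w : α → ℝ) (G : ι → α → Prop) :
    Pw (fun b : ι → α => ∏ i, w (b i)) (fun b => ∀ i, G i (b i)) = ∏ i, Pw w (G i) := by
  classical
  unfold Pw
  rw [Finset.prod_univ_sum, Fintype.piFinset_univ]
  refine Finset.sum_congr rfl fun b _ => ?_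
  split_ifs with h
  · exact Finset.prod_congr rfl fun i _ => by simp [h i]
  · push Not at h
    obtain ⟨i, hi⟩ := h
    exact (Finset.prod_eq_zero (Finset.mem_univ i) (by simp [hi])).symm

end helpers

noncomputable def wB (p : ℝ) (v : Bool) : ℝ := if v then p else 1 - p
noncomputable def wR (n : ℕ) (p : ℝ) (r : Fin n → Bool) : ℝ := ∏ j, wB p (r j)
noncomputable def wM (n : ℕ) (p : ℝ) (b : Fin n → Fin n → Bool) : ℝ := ∏ i, wR n p (b i)
noncomputable def wT (n m : ℕ) (p : ℝ) (b : Fin m → Fin n → Fin n → Bool) : ℝ :=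
  ∏ k, wM n p (b k)

lemma bernoulliProb_eq (n m : ℕ) (p : ℝ) (E : (Fin m → Matrix (Fin n) (Fin n) ℕ) → Prop) :
    bernoulliProb n m p E = Pw (wT n m p) (fun b => E (fun k => toMat (b k))) := rfl

section weights

lemma wB_nonneg {p : ℝ} (h0 : 0 ≤ p) (h1 : p ≤ 1) (v : Bool) : 0 ≤ wB p v := by
  unfold wB; split_ifs <;> linarith
lemma wR_nonneg {p : ℝ} (h0 : 0 ≤ p) (h1 : p ≤ 1) (n : ℕ) (r : Fin n → Bool) : 0 ≤ wR n p r := Finset.prod_nonneg fun _ _ => wB_nonneg h0 h1 _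
lemma wM_nonneg {p : ℝ} (h0 : 0 ≤ p) (h1 : p ≤ 1) (n : ℕ) (r : Fin n → Fin n → Bool) : 0 ≤ wM n p r := Finset.prod_nonneg fun _ _ => wR_nonneg h0 h1 _ _
lemma wT_nonneg {p : ℝ} (h0 : 0 ≤ p) (h1 : p ≤ 1) (n m : ℕ) (r : Fin m → Fin n → Fin n → Bool) : 0 ≤ wT n m p r := Finset.prod_nonneg fun _ _ => wM_nonneg h0 h1 _ _

end weights

section weights2
variable (p : ℝ) (n m : ℕ)

lemma PwB_true : Pw (wB p) (fun _ => True) = 1 := by simp [Pw, wB]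
lemma PwB_eq_true : Pw (wB p) (fun v => v = true) = p := by simp [Pw, wB]
lemma PwB_eq_false : Pw (wB p) (fun v => v = false) = 1 - p := by simp [Pw, wB]

lemma PwR_pi (G : Fin n → Bool → Prop) :
    Pw (wR n p) (fun r => ∀ j, G j (r j)) = ∏ j, Pw (wB p) (G j) := Pw_pi _ _
lemma PwM_pi (G : Fin n → (Fin n → Bool) → Prop) :
    Pw (wM n p) (fun r => ∀ j, G j (r j)) = ∏ j, Pw (wR n p) (G j) := Pw_pi _ _
lemma PwT_pi (G : Fin m → (Fin n → Fin n → Bool) → Prop) :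
    Pw (wT n m p) (fun r => ∀ j, G j (r j)) = ∏ j, Pw (wM n p) (G j) := Pw_pi _ _

lemma PwR_true : Pw (wR n p) (fun _ => True) = 1 := by
  simpa [PwB_true] using PwR_pi p n (fun _ _ => True)
lemma PwM_true : Pw (wM n p) (fun _ => True) = 1 := by
  simpa [PwR_true] using PwM_pi p n (fun _ _ => True)
lemma PwT_true : Pw (wT n m p) (fun _ => True) = 1 := by
  simpa [PwM_true] using PwT_pi p n m (fun _ _ => True)

lemma PwR_nz : Pw (wR n p) (fun r => ¬ ∀ j, r j = false) = 1 - (1 - p) ^ n := by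
  rw [Pw_compl, PwR_true, PwR_pi p n (fun _ v => v = false)]
  simp [PwB_eq_false]

def NZ {n : ℕ} (b : Fin n → Fin n → Bool) : Prop := ∀ i, ¬ ∀ j, b i j = false

lemma PwM_NZ : Pw (wM n p) NZ = (1 - (1 - p) ^ n) ^ n := by
  have := PwM_pi p n (fun _ r => ¬ ∀ j, r j = false)
  simp only [PwR_nz, Finset.prod_const, Finset.card_univ, Fintype.card_fin] at this
  exact this

lemma PwT_NZ : Pw (wT n m p) (fun b => ∃ k, NZ (b k)) =
    1 - (1 - (1 - (1 - p) ^ n) ^ n) ^ m := by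
  have h1 := PwT_pi p n m (fun _ b => ¬ NZ b)
  simp only [Pw_compl, PwM_true, PwM_NZ, Finset.prod_const, Finset.card_univ,
    Fintype.card_fin] at h1
  rw [← h1, ← PwT_true p n m, ← Pw_compl]
  simp

lemma PwT_one (k : Fin m) (G : (Fin n → Fin n → Bool) → Prop) :
    Pw (wT n m p) (fun b => G (b k)) = Pw (wM n p) G := by
  have h := PwT_pi p n m (fun l b => l = k → G b)
  have e : (fun r : Fin m → Fin n → Fin n → Bool => ∀ j, j = k → G (r j)) =
    fun r => G (r k) := by funext r; simp
  rw [e] at h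
  rw [h, Finset.prod_eq_single k]
  · simp
  · intro l _ hl
    simp [hl, PwM_true]
  · simp

lemma PwM_diag : Pw (wM n p) (fun b => ∀ j, b j j = false) = (1 - p) ^ n := by
  have h := PwM_pi p n (fun i r => r i = false)
  rw [h]
  have : ∀ i : Fin n, Pw (wR n p) (fun r => r i = false) = 1 - p := by
    intro i
    have h := PwR_pi p n (fun l v => l = i → v = false)
    have e : (fun r : Fin n → Bool => ∀ j, j = i → r j = false) =
      fun r => r i = false := by funext r; simp
    rw [e] at h
    rw [h, Finset.prod_eq_single i]
    · simp [PwB_eq_false]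
    · intro l _ hl
      simp [hl, PwB_true]
    · simp
  simp [this]

lemma PwM_pat (x : Fin n × Fin n) (Z : Finset (Fin n × Fin n)) (hx : x ∉ Z) :
    Pw (wM n p) (fun b => b x.1 x.2 = true ∧ ∀ y ∈ Z, b y.1 y.2 = false) =
      p * (1 - p) ^ Z.card := by
  classical
  have e : (fun b : Fin n → Fin n → Bool => b x.1 x.2 = true ∧ ∀ y ∈ Z, b y.1 y.2 = false) =
    fun b => ∀ i j, ((i, j) = x → b i j = true) ∧ ((i, j) ∈ Z → b i j = false) := by
    funext b
    apply propext
    constructor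
    · rintro ⟨h1, h2⟩ i j
      exact ⟨fun h => by rw [← h] at h1; exact h1, fun h => h2 _ h⟩
    · intro h
      exact ⟨(h _ _).1 rfl, fun y hy => (h _ _).2 hy⟩
  rw [e, PwM_pi p n (fun i r => ∀ j, ((i, j) = x → r j = true) ∧ ((i, j) ∈ Z → r j = false))]
  have e2 : ∀ i : Fin n, Pw (wR n p)
      (fun r => ∀ j, ((i, j) = x → r j = true) ∧ ((i, j) ∈ Z → r j = false)) =
      ∏ j, ((if (i, j) = x then p else 1) * (if (i, j) ∈ Z then 1 - p else 1)) := by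
    intro i
    rw [PwR_pi p n (fun j v => ((i, j) = x → v = true) ∧ ((i, j) ∈ Z → v = false))]
    refine Finset.prod_congr rfl fun j _ => ?_
    by_cases h1 : (i, j) = x
    · have : (i, j) ∉ Z := h1 ▸ hx
      simp only [h1, hx]
      simp [PwB_eq_true]
    · by_cases h2 : (i, j) ∈ Z
      · simp [h1, h2, PwB_eq_false]
      · simp [h1, h2, PwB_true]
  simp only [e2]
  rw [← Fintype.prod_prod_type' (f := fun i j => ((if (i, j) = x then p else 1) * (if (i, j) ∈ Z then 1 - p else 1)))]
  rw [Finset.prod_mul_distrib]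
  simp

end weights2

def Bad {n : ℕ} (b : Fin n → Fin n → Bool) : Prop :=
  (∀ j, b j j = false) ∨
  ∃ U ∈ (Finset.univ : Finset (Finset (Fin n))).filter (fun U => 2 * U.card ≤ n),
    ∃ x ∈ U ×ˢ U, (b x.1 x.2 = true ∧ ∀ y ∈ U ×ˢ Uᶜ, b y.1 y.2 = false) ∨
      (b x.1 x.2 = true ∧ ∀ y ∈ Uᶜ ×ˢ U, b y.1 y.2 = false)

lemma PwM_Bad {p : ℝ} (h0 : 0 ≤ p) (h1 : p ≤ 1) (n : ℕ) :
    Pw (wM n p) Bad ≤ (1 - p) ^ n +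
      2 * ∑ t ∈ (Finset.range (n + 1)).filter (fun t => 2 * t ≤ n),
        (n.choose t : ℝ) * ((t : ℝ) ^ 2 * (p * (1 - p) ^ (t * (n - t)))) := by
  classical
  have hw := wM_nonneg h0 h1 n
  refine (Pw_or hw).trans ?_
  rw [PwM_diag]
  gcongr
  refine (Pw_biUnion hw _ _).trans ?_
  have key : ∀ U : Finset (Fin n), Pw (wM n p) (fun b => ∃ x ∈ U ×ˢ U,
      (b x.1 x.2 = true ∧ ∀ y ∈ U ×ˢ Uᶜ, b y.1 y.2 = false) ∨
      (b x.1 x.2 = true ∧ ∀ y ∈ Uᶜ ×ˢ U, b y.1 y.2 = false)) ≤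
      2 * ((U.card : ℝ) ^ 2 * (p * (1 - p) ^ (U.card * (n - U.card)))) := by
    intro U
    refine (Pw_biUnion hw _ _).trans ?_
    have : ∀ x ∈ U ×ˢ U, Pw (wM n p) (fun b => 
      (b x.1 x.2 = true ∧ ∀ y ∈ U ×ˢ Uᶜ, b y.1 y.2 = false) ∨
      (b x.1 x.2 = true ∧ ∀ y ∈ Uᶜ ×ˢ U, b y.1 y.2 = false)) ≤
      2 * (p * (1 - p) ^ (U.card * (n - U.card))) := by
      intro x hx
      rw [Finset.mem_product] at hx
      refine (Pw_or hw).trans (le_of_eq ?_)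
      rw [PwM_pat p n x _ (by simp [hx]), PwM_pat p n x _ (by simp [hx])]
      simp only [Finset.card_product, Finset.card_compl, Fintype.card_fin]
      rw [mul_comm (n - U.card)]
      ring
    refine (Finset.sum_le_sum this).trans (le_of_eq ?_)
    rw [Finset.sum_const, Finset.card_product, nsmul_eq_mul]
    push_cast
    ring
  refine (Finset.sum_le_sum fun U _ => key U).trans (le_of_eq ?_)
  rw [← Finset.mul_sum]
  congr 1
  rw [Finset.sum_filter, ← Finset.powerset_univ, 
    Finset.sum_powerset_apply_card (fun t => if 2 * t ≤ n then ((t:ℝ)^2 * (p * (1 - p) ^ (t * (n - t)))) else 0)]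
  rw [Finset.sum_filter]
  simp [nsmul_eq_mul]

lemma not_bad_dir {n m : ℕ} (b : Fin m → Fin n → Fin n → Bool) (k : Fin m)
    (hz : NZ (b k)) (hb : ¬ Bad (b k)) : Is3Directable (fun k => toMat (b k)) := by
  classical
  unfold Bad at hb
  push Not at hb
  obtain ⟨⟨j, hj⟩, hU⟩ := hb
  have hjj : b k j j = true := by simpa using hj
  set A := toMat (b k) with hA
  have hA1 : ∀ i i', b k i i' = true → 0 < A i i' := by
    intro i i' h; simp [hA, toMat, h]
  have step : ∀ i i' l, b k i i' = true → 0 < (A ^ l) i' j → 0 < (A ^ (l + 1)) i j := by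
    intro i i' l h1 h2
    rw [pow_succ', Matrix.mul_apply]
    exact Finset.sum_pos' (fun _ _ => Nat.zero_le _)
      ⟨i', Finset.mem_univ _, Nat.mul_pos (hA1 _ _ h1) h2⟩
  have step' : ∀ i l, 0 < (A ^ l) i j → 0 < (A ^ (l + 1)) i j := by
    intro i l h
    rw [pow_succ, Matrix.mul_apply]
    exact Finset.sum_pos' (fun _ _ => Nat.zero_le _)
      ⟨j, Finset.mem_univ _, Nat.mul_pos h (hA1 _ _ hjj)⟩
  have mono : ∀ i l d, 0 < (A ^ l) i j → 0 < (A ^ (l + d)) i j := by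
    intro i l d h
    induction d with
    | zero => exact h
    | succ d ih => exact step' _ _ ih
  by_cases hall : ∀ i, ∃ l, 0 < (A ^ l) i j
  · choose f hf using hall
    refine ⟨List.replicate (∑ i, f i + 1) k, by simp, j, fun i => ?_⟩
    rw [List.map_replicate, List.prod_replicate]
    apply step'
    obtain ⟨d, hd⟩ := Nat.exists_eq_add_of_le
      (Finset.single_le_sum (f := f) (fun _ _ => Nat.zero_le _) (Finset.mem_univ i))
    rw [hd]
    exact mono _ _ _ (hf i)
  · exfalso
    push Not at hall
    obtain ⟨i0, hi0⟩ := hall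
    set R : Finset (Fin n) := Finset.univ.filter (fun i => ∃ l, 0 < (A ^ l) i j) with hR
    have hjR : j ∈ R := by simp only [hR, Finset.mem_filter, Finset.mem_univ, true_and]; exact ⟨0, by simp⟩
    have hi0R : i0 ∉ R := by
      simp only [hR, Finset.mem_filter, Finset.mem_univ, true_and]
      rintro ⟨l, hl⟩
      have := hi0 l
      omega
    have hcl : ∀ i ∉ R, ∀ i' ∈ R, b k i i' = false := by
      intro i hi i' hi'
      by_contra h
      simp only [Bool.not_eq_false] at h
      simp only [hR, Finset.mem_filter, Finset.mem_univ, true_and] at hi hi'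
      obtain ⟨l, hl⟩ := hi'
      exact hi ⟨l + 1, step _ _ _ h hl⟩
    have hcard : R.card + Rᶜ.card = n := by
      rw [Finset.card_add_card_compl]; simp
    by_cases hc : 2 * R.card ≤ n
    · obtain ⟨y, hy, h⟩ := (hU R (by simp [hc]) (j, j) (by simp [hjR])).2 hjj
      rw [Finset.mem_product, Finset.mem_compl] at hy
      exact h (hcl _ hy.1 _ hy.2)
    · have h1 := hz i0
      push Not at h1
      obtain ⟨i1, h1⟩ := h1
      have h1' : b k i0 i1 = true := by simpa using h1
      have hi1 : i1 ∉ R := fun h => h1 (hcl _ hi0R _ h)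
      obtain ⟨y, hy, h⟩ := (hU Rᶜ (by simp only [Finset.mem_filter, Finset.mem_univ, true_and]; omega)
        (i0, i1) (by simp [hi0R, hi1])).1 h1'
      rw [Finset.mem_product, compl_compl, Finset.mem_compl] at hy
      exact h (hcl _ hy.1 _ hy.2)

lemma dir_NZ {n m : ℕ} (b : Fin m → Fin n → Fin n → Bool)
    (h : Is3Directable (fun k => toMat (b k))) : ∃ k, NZ (b k) := by
  obtain ⟨w, hw, j, hj⟩ := h
  cases w with
  | nil => exact absurd rfl hw
  | cons k w =>
    refine ⟨k, fun i hi => ?_⟩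
    have := hj i
    rw [List.map_cons, List.prod_cons, Matrix.mul_apply] at this
    simp [toMat, hi] at this

lemma prob_upper {p : ℝ} (h0 : 0 ≤ p) (h1 : p ≤ 1) (n m : ℕ) :
    bernoulliProb n m p (fun M => Is3Directable M) ≤ 1 - (1 - (1 - (1 - p) ^ n) ^ n) ^ m := by
  rw [bernoulliProb_eq, ← PwT_NZ]
  exact Pw_mono (wT_nonneg h0 h1 n m) fun b => dir_NZ b

lemma prob_lower_s10 {p : ℝ} (h0 : 0 ≤ p) (h1 : p ≤ 1) (n m : ℕ) :
    1 - (1 - (1 - (1 - p) ^ n) ^ n) ^ m - m * Pw (wM n p) Bad ≤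
      bernoulliProb n m p (fun M => Is3Directable M) := by
  have hw := wT_nonneg h0 h1 n m
  rw [bernoulliProb_eq, ← PwT_NZ, sub_le_iff_le_add]
  refine (Pw_mono hw (F := fun b => Is3Directable (fun k => toMat (b k)) ∨
    ∃ k ∈ Finset.univ, Bad (b k)) ?_).trans ?_
  · rintro b ⟨k, hk⟩
    by_cases hb : Bad (b k)
    · exact Or.inr ⟨k, Finset.mem_univ _, hb⟩
    · exact Or.inl (not_bad_dir b k hk hb)
  · refine (Pw_or hw).trans ?_
    gcongr
    refine (Pw_biUnion hw _ _).trans (le_of_eq ?_)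
    simp [PwT_one]

lemma term_bound {p c : ℝ} {n t : ℕ} (h1 : p ≤ 1) (hn : 0 < n)
    (hp : n * p = Real.log n + c) (ht : 2 * t ≤ n)
    (hε : Real.exp (1 - c) * (2 / n * Real.exp (n * p / 2)) ≤ 1 / 4) :
    (n.choose t : ℝ) * (1 - p) ^ (t * (n - t)) ≤ (Real.exp (1 - c) / t + 1 / 4) ^ t := by
  rcases Nat.eq_zero_or_pos t with rfl | htp
  · simp
  have hnR : (0 : ℝ) < n := by exact_mod_cast hn
  have htR : (0 : ℝ) < t := by exact_mod_cast htp
  have hq : 0 ≤ 1 - p := by linarith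
  have a1 : (n.choose t : ℝ) ≤ (n : ℝ) ^ t / t.factorial := Nat.choose_le_pow_div t n
  have a2 : (t : ℝ) ^ t / t.factorial ≤ Real.exp t := Real.pow_div_factorial_le_exp _ htR.le _
  have a3 : (n.choose t : ℝ) ≤ (n * Real.exp 1 / t) ^ t := by
    have e : (n * Real.exp 1 / t) ^ t = (n : ℝ) ^ t / (t : ℝ) ^ t * Real.exp t := by
      rw [div_pow, mul_pow, ← Real.exp_nat_mul]; ring_nf
    rw [e]
    refine a1.trans ?_
    calc (n : ℝ) ^ t / t.factorial = (n : ℝ) ^ t / (t : ℝ) ^ t * ((t : ℝ) ^ t / t.factorial) := by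
          field_simp
      _ ≤ _ := by gcongr
  have a4 : (1 - p) ^ (t * (n - t)) ≤ (Real.exp (-(p * (n - t)))) ^ t := by
    rw [mul_comm, pow_mul]
    gcongr
    have : (1 - p) ^ (n - t) ≤ (Real.exp (-p)) ^ (n - t) := by
      gcongr
      have := Real.add_one_le_exp (-p)
      linarith
    refine this.trans (le_of_eq ?_)
    rw [← Real.exp_nat_mul, Nat.cast_sub (by omega)]
    ring_nf
  have a5 : n * Real.exp (-(p * (n - t))) = Real.exp (-c) * Real.exp (p * t) := by
    nth_rewrite 1 [← Real.exp_log hnR]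
    rw [← Real.exp_add, ← Real.exp_add]
    congr 1
    linarith
  have a6 : Real.exp (p * t) ≤ 1 + 2 * t / n * Real.exp (n * p / 2) := by
    have hs : (2 * t / n : ℝ) ≤ 1 := by
      rw [div_le_one hnR]; exact_mod_cast ht
    have hs0 : (0 : ℝ) ≤ 2 * t / n := by positivity
    have := convexOn_exp.2 (Set.mem_univ (0 : ℝ)) (Set.mem_univ (n * p / 2))
      (show (0 : ℝ) ≤ 1 - 2 * t / n by linarith) hs0 (by ring)
    simp only [smul_eq_mul, mul_zero, zero_add, Real.exp_zero, mul_one] at this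
    have e : (2 * t / n : ℝ) * (n * p / 2) = p * t := by field_simp
    rw [e] at this
    linarith
  calc (n.choose t : ℝ) * (1 - p) ^ (t * (n - t))
      ≤ (n * Real.exp 1 / t) ^ t * (Real.exp (-(p * (n - t)))) ^ t := by gcongr
    _ = (Real.exp 1 / t * (n * Real.exp (-(p * (n - t))))) ^ t := by
        rw [← mul_pow]; ring_nf
    _ = (Real.exp (1 - c) / t * Real.exp (p * t)) ^ t := by
        rw [a5, sub_eq_add_neg, Real.exp_add]; ring_nf
    _ ≤ (Real.exp (1 - c) / t * (1 + 2 * t / n * Real.exp (n * p / 2))) ^ t := by gcongr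
    _ = (Real.exp (1 - c) / t + Real.exp (1 - c) * (2 / n * Real.exp (n * p / 2))) ^ t := by
        congr 1; field_simp
    _ ≤ _ := by gcongr

lemma summable_g (K : ℝ) (hK : 0 < K) :
    Summable (fun t : ℕ => (t : ℝ) ^ 2 * (K / t + 1 / 4) ^ t) := by
  have h := summable_pow_mul_geometric_of_norm_lt_one (R := ℝ) 2 (r := 1 / 2) (by norm_num)
  refine Summable.of_norm_bounded_eventually_nat h ?_
  filter_upwards [eventually_ge_atTop (Nat.ceil (4 * K)), eventually_gt_atTop 0] with t ht ht0
  have ht' : 4 * K ≤ t := Nat.ceil_le.mp ht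
  have htR : (0 : ℝ) < t := by exact_mod_cast ht0
  rw [Real.norm_of_nonneg (by positivity)]
  gcongr
  have : K / t ≤ 1 / 4 := by rw [div_le_iff₀ htR]; linarith
  linarith

lemma sum_bound_s10 {p c : ℝ} {n : ℕ} (h0 : 0 ≤ p) (h1 : p ≤ 1) (hn : 0 < n)
    (hp : n * p = Real.log n + c)
    (hε : Real.exp (1 - c) * (2 / n * Real.exp (n * p / 2)) ≤ 1 / 4) :
    ∑ t ∈ (Finset.range (n + 1)).filter (fun t => 2 * t ≤ n),
        (n.choose t : ℝ) * ((t : ℝ) ^ 2 * (p * (1 - p) ^ (t * (n - t)))) ≤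
    p * ∑' t : ℕ, (t : ℝ) ^ 2 * (Real.exp (1 - c) / t + 1 / 4) ^ t := by
  calc _ ≤ ∑ t ∈ (Finset.range (n + 1)).filter (fun t => 2 * t ≤ n),
        p * ((t : ℝ) ^ 2 * (Real.exp (1 - c) / t + 1 / 4) ^ t) := by
        refine Finset.sum_le_sum fun t ht => ?_
        rw [Finset.mem_filter] at ht
        have := term_bound h1 hn hp ht.2 hε
        calc _ = p * ((t : ℝ) ^ 2 * ((n.choose t : ℝ) * (1 - p) ^ (t * (n - t)))) := by ring
          _ ≤ _ := by gcongr
    _ ≤ _ := by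
        rw [← Finset.mul_sum]
        gcongr
        exact (summable_g _ (Real.exp_pos _)).sum_le_tsum _ (fun t _ => by positivity)

section limits
variable (c : ℝ)

lemma lim_log : Tendsto (fun n : ℕ => Real.log n) atTop atTop :=
  Real.tendsto_log_atTop.comp tendsto_natCast_atTop_atTop

lemma lim_p : Tendsto (fun n : ℕ => (Real.log n + c) / n) atTop (nhds 0) := by
  have h := (Real.isLittleO_log_id_atTop.tendsto_div_nhds_zero).comp
    (tendsto_natCast_atTop_atTop (R := ℝ))
  have h2 := tendsto_const_div_atTop_nhds_zero_nat c
  have := h.add h2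
  simp only [add_zero] at this
  refine this.congr fun n => ?_
  simp [add_div]

lemma lim_np2 : Tendsto (fun n : ℕ => (n : ℝ) * ((Real.log n + c) / n) ^ 2) atTop (nhds 0) := by
  have h : Tendsto (fun n : ℕ => Real.log n ^ 2 / (n : ℝ)) atTop (nhds 0) := by
    have := ((isLittleO_log_rpow_atTop (r := 1 / 2) (by norm_num)).tendsto_div_nhds_zero).comp
      (tendsto_natCast_atTop_atTop (R := ℝ))
    have := this.pow 2
    simp only [ne_eq, OfNat.ofNat_ne_zero, not_false_eq_true, zero_pow] at this
    refine this.congr fun n => ?_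
    simp only [Function.comp, div_pow]
    rw [← Real.rpow_natCast ((n : ℝ) ^ (1 / 2 : ℝ)), ← Real.rpow_mul (by positivity)]
    norm_num
  have h1 := (Real.isLittleO_log_id_atTop.tendsto_div_nhds_zero).comp
    (tendsto_natCast_atTop_atTop (R := ℝ))
  have h2 := tendsto_const_div_atTop_nhds_zero_nat (c ^ 2)
  have := (h.add (h1.const_mul (2 * c))).add h2
  simp only [add_zero, mul_zero] at this
  refine this.congr' ?_
  filter_upwards [eventually_gt_atTop 0] with n hn
  have hnR : (n : ℝ) ≠ 0 := by positivity
  simp only [Function.comp, id]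
  field_simp
  ring

lemma lim_q : Tendsto (fun n : ℕ => (n : ℝ) * (1 - (Real.log n + c) / n) ^ n) atTop
    (nhds (Real.exp (-c))) := by
  have hlow : Tendsto (fun n : ℕ => Real.exp (-c) * Real.exp (-2 * ((n : ℝ) * ((Real.log n + c) / n) ^ 2)))
      atTop (nhds (Real.exp (-c))) := by
    have := (Real.continuous_exp.tendsto _).comp ((lim_np2 c).const_mul (-2))
    simpa using this.const_mul (Real.exp (-c))
  refine tendsto_of_tendsto_of_tendsto_of_le_of_le' hlow tendsto_const_nhds ?_ ?_
  all_goals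
    filter_upwards [eventually_gt_atTop 0, (lim_p c).eventually_le_const (by norm_num : (0:ℝ) < 1 / 2)]
      with n hn hp
    have hnR : (0 : ℝ) < n := by exact_mod_cast hn
    have hnp : (n : ℝ) * ((Real.log n + c) / n) = Real.log n + c := by field_simp
    set p := (Real.log n + c) / n
    have hid : (n : ℝ) * Real.exp (-(n * p)) = Real.exp (-c) := by
      nth_rewrite 1 [← Real.exp_log hnR]
      rw [← Real.exp_add]
      congr 1
      linarith
  · have h1 : Real.exp (-p - 2 * p ^ 2) ≤ 1 - p := by
      rw [← Real.le_log_iff_exp_le (by linarith)]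
      have := Real.one_sub_inv_le_log_of_pos (show 0 < 1 - p by linarith)
      refine le_trans ?_ this
      have h2 : 0 < 1 - p := by linarith
      have : (1 - p)⁻¹ ≤ 1 + p + 2 * p ^ 2 := by
        rw [inv_le_iff_one_le_mul₀ h2]
        nlinarith [sq_nonneg p]
      linarith
    rw [← hid, mul_assoc]
    gcongr
    calc _ = (Real.exp (-p - 2 * p ^ 2)) ^ n := by
          rw [← Real.exp_add, ← Real.exp_nat_mul]; ring_nf
      _ ≤ _ := by gcongr
  · rw [← hid]
    gcongr
    calc (1 - p) ^ n ≤ (Real.exp (-p)) ^ n := by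
          have := Real.add_one_le_exp (-p)
          gcongr
          · linarith
          · linarith
      _ = _ := by rw [← Real.exp_nat_mul]; ring_nf

lemma lim_q0 : Tendsto (fun n : ℕ => (1 - (Real.log n + c) / n) ^ n) atTop (nhds 0) := by
  have := (lim_q c).mul (tendsto_const_div_atTop_nhds_zero_nat 1)
  rw [mul_zero] at this
  refine this.congr' ?_
  filter_upwards [eventually_gt_atTop 0] with n hn
  have hnR : (n : ℝ) ≠ 0 := by positivity
  field_simp

lemma lim_NZ : Tendsto (fun n : ℕ => (1 - (1 - (Real.log n + c) / n) ^ n) ^ n) atTop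
    (nhds (Real.exp (-Real.exp (-c)))) := by
  have := Real.tendsto_one_add_pow_exp_of_tendsto
    (g := fun n : ℕ => -(1 - (Real.log n + c) / n) ^ n) (t := -Real.exp (-c)) (by
      simpa using (lim_q c).neg)
  simpa [sub_eq_add_neg] using this

lemma lim_eps : Tendsto (fun n : ℕ => Real.exp (1 - c) * (2 / n * Real.exp (n * ((Real.log n + c) / n) / 2)))
    atTop (nhds 0) := by
  have h : Tendsto (fun n : ℕ => Real.exp (1 - c) * (2 * Real.exp (c / 2)) *
      Real.exp (-(Real.log n / 2))) atTop (nhds 0) := by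
    have := Real.tendsto_exp_neg_atTop_nhds_zero.comp (lim_log.atTop_div_const (by norm_num : (0:ℝ) < 2))
    simpa using this.const_mul (Real.exp (1 - c) * (2 * Real.exp (c / 2)))
  refine h.congr' ?_
  filter_upwards [eventually_gt_atTop 0] with n hn
  have hnR : (0 : ℝ) < n := by exact_mod_cast hn
  have hnp : (n : ℝ) * ((Real.log n + c) / n) = Real.log n + c := by field_simp
  rw [hnp]
  have e : (2 / n : ℝ) = 2 * Real.exp (-Real.log n) := by
    rw [Real.exp_neg, Real.exp_log hnR]; ring
  rw [e, mul_assoc, mul_assoc, mul_assoc, ← Real.exp_add, ← Real.exp_add]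
  congr 3
  ring

lemma lim_Bad : Tendsto (fun n : ℕ => Pw (wM n ((Real.log n + c) / n)) Bad) atTop (nhds 0) := by
  have hup := (lim_q0 c).add (((lim_p c).mul_const
    (∑' t : ℕ, (t : ℝ) ^ 2 * (Real.exp (1 - c) / t + 1 / 4) ^ t)).const_mul 2)
  simp only [zero_mul, mul_zero, add_zero] at hup
  refine tendsto_of_tendsto_of_tendsto_of_le_of_le' tendsto_const_nhds hup ?_ ?_
  all_goals
    filter_upwards [eventually_gt_atTop 0, (lim_p c).eventually_le_const (by norm_num : (0:ℝ) < 1),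
      lim_log.eventually_ge_atTop (-c), (lim_eps c).eventually_le_const (by norm_num : (0:ℝ) < 1 / 4)]
      with n hn hp hl hε
    have hnR : (0 : ℝ) < n := by exact_mod_cast hn
    have hnp : (n : ℝ) * ((Real.log n + c) / n) = Real.log n + c := by field_simp
    have hp0 : 0 ≤ (Real.log n + c) / n := div_nonneg (by linarith) hnR.le
  · exact Pw_nonneg (wM_nonneg hp0 hp n)
  · refine (PwM_Bad hp0 hp n).trans ?_
    gcongr
    exact sum_bound_s10 hp0 hp hn hnp hε

lemma lim_prob (m : ℕ) : Tendsto (fun n : ℕ =>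
    bernoulliProb n m ((Real.log n + c) / n) (fun M => Is3Directable M)) atTop
    (nhds (1 - (1 - Real.exp (-Real.exp (-c))) ^ m)) := by
  have hup := (((lim_NZ c).const_sub 1).pow m).const_sub 1
  have hlow := hup.sub ((lim_Bad c).const_mul (m : ℝ))
  rw [mul_zero, sub_zero] at hlow
  refine tendsto_of_tendsto_of_tendsto_of_le_of_le' hlow hup ?_ ?_
  all_goals
    filter_upwards [eventually_gt_atTop 0, (lim_p c).eventually_le_const (by norm_num : (0:ℝ) < 1),
      lim_log.eventually_ge_atTop (-c)] with n hn hp hl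
    have hp0 : 0 ≤ (Real.log n + c) / n := div_nonneg (by linarith) (by positivity)
  · exact prob_lower_s10 hp0 hp n m
  · exact prob_upper hp0 hp n m

end limits

/-- Let `m ≥ 2`, `c ∈ ℝ` and `p̂ n = (log n + c)/n`.  With
`a(m,c) = 1 − (1 − e^{−2e^{−c}})^m − m·e^{−2e^{−c}}·(1 − e^{−2e^{−c}})^{m−1}`, one has
`a(m,c) ≤ liminf P(B_m(n, p̂ n) is 3-directable)` and
`limsup P(B_m(n, p̂ n) is 3-directable) ≤ 1 − (1 − e^{−e^{−c}})^m`. -/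
theorem stmt10 (m : ℕ) (hm : 2 ≤ m) (c : ℝ) :
    1 - (1 - Real.exp (-2 * Real.exp (-c))) ^ m -
        m * Real.exp (-2 * Real.exp (-c)) *
          (1 - Real.exp (-2 * Real.exp (-c))) ^ (m - 1) ≤
      liminf (fun n : ℕ =>
        bernoulliProb n m ((Real.log n + c) / n) (fun M => Is3Directable M)) atTop ∧
    limsup (fun n : ℕ =>
        bernoulliProb n m ((Real.log n + c) / n) (fun M => Is3Directable M)) atTop ≤
      1 - (1 - Real.exp (-Real.exp (-c))) ^ m := by
  have h := lim_prob c m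
  rw [h.liminf_eq, h.limsup_eq]
  refine ⟨?_, le_rfl⟩
  have e : Real.exp (-2 * Real.exp (-c)) ≤ Real.exp (-Real.exp (-c)) := by
    apply Real.exp_le_exp.mpr
    have := Real.exp_pos (-c)
    linarith
  have hq : Real.exp (-Real.exp (-c)) ≤ 1 := by
    apply Real.exp_le_one_iff.mpr
    have := Real.exp_pos (-c)
    linarith
  have h1 : (1 - Real.exp (-Real.exp (-c))) ^ m ≤ (1 - Real.exp (-2 * Real.exp (-c))) ^ m := by
    gcongr
  have h2 : 0 ≤ m * Real.exp (-2 * Real.exp (-c)) *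
      (1 - Real.exp (-2 * Real.exp (-c))) ^ (m - 1) := by
    have : 0 ≤ 1 - Real.exp (-2 * Real.exp (-c)) := by linarith
    positivity
  linarith
end

section
/- Let n = 4k with k ≥ 2 an integer. Let q_1 be the permutation of {1,...,n} with q_1(1)=1, q_1(n)=n, q_1(i)=i+1 for even i with 2 ≤ i ≤ n−2, q_1(i)=i−1 for odd i with 3 ≤ i ≤ n−1, and q_2 the permutation with q_2(i)=i−1 for even i and q_2(i)=i+1 for odd i; let Q_1, Q_2 be their permutation matrices. Let E_n be the DFA with the three letters Ī_{1,n−2}, Q_1, Q_2, where Ī_{1,n−2} is the binary row-stochastic matrix of the map sending state 1 to state n−2 and fixing every other state. Then E_n is synchronizing and the diameter of its square graph S(E_n) equals (n² + 2n − 4)/4. -/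
open Matrix

/-- The 0/1 matrix of a map on states `{1, ..., n}` described by `f : ℕ → ℕ`
(state `a` corresponds to the index `a.val + 1`): entry `(a, b)` is `1` iff
`f (a+1) = b+1` in the 1-indexed labels. -/
def matOfFun (n : ℕ) (f : ℕ → ℕ) : Matrix (Fin n) (Fin n) ℕ :=
  Matrix.of fun a b => if f (a.val + 1) = b.val + 1 then 1 else 0

/-- The permutation matrix of `q₁` with `q₁(1)=1`, `q₁(n)=n`, `q₁(i)=i+1` for even `i`
with `2 ≤ i ≤ n−2`, `q₁(i)=i−1` for odd `i` with `3 ≤ i ≤ n−1`. -/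
def Q1mat (n : ℕ) : Matrix (Fin n) (Fin n) ℕ :=
  matOfFun n fun s => if s = 1 then 1 else if s = n then n
    else if s % 2 = 0 then s + 1 else s - 1

/-- The permutation matrix of `q₂` with `q₂(i)=i−1` for even `i`, `q₂(i)=i+1` for odd
`i`. -/
def Q2mat (n : ℕ) : Matrix (Fin n) (Fin n) ℕ :=
  matOfFun n fun s => if s % 2 = 0 then s - 1 else s + 1

/-- The letter `Ī_{1,n−2}`: the row-stochastic matrix of the map sending state `1` to
state `n − 2` and fixing every other state. -/
def IbarMat (n : ℕ) : Matrix (Fin n) (Fin n) ℕ :=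
  matOfFun n fun s => if s = 1 then n - 2 else s

/-- The DFA `E_n` on `n` states with the three letters `Ī_{1,n−2}, Q₁, Q₂`. -/
def En (n : ℕ) : Set (Matrix (Fin n) (Fin n) ℕ) :=
  {IbarMat n, Q1mat n, Q2mat n}

/-- A DFA (set of row-stochastic matrices) `S` is synchronizing: some nonempty product of
its matrices has an all-positive column. -/
def IsSync {n : ℕ} (S : Set (Matrix (Fin n) (Fin n) ℕ)) : Prop :=
  ∃ ws : List (Matrix (Fin n) (Fin n) ℕ), ws ≠ [] ∧ (∀ A ∈ ws, A ∈ S) ∧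
    ∃ j, ∀ i, 0 < ws.prod i j

/-- One edge of the square graph of the DFA `S`: the (unordered) pair `u` moves to the
pair `v` by some letter of `S`. -/
def sqStep {n : ℕ} (S : Set (Matrix (Fin n) (Fin n) ℕ))
    (u v : Fin n × Fin n) : Prop :=
  ∃ A ∈ S, (0 < A u.1 v.1 ∧ 0 < A u.2 v.2) ∨ (0 < A u.1 v.2 ∧ 0 < A u.2 v.1)

/-- `stepsTo r k u v`: there is a directed path of length `k` from `u` to `v` using the
edge relation `r`. -/
def stepsTo {V : Type*} (r : V → V → Prop) : ℕ → V → V → Prop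
  | 0, u, v => u = v
  | k + 1, u, v => ∃ w, r u w ∧ stepsTo r k w v

/-- The distance in the square graph from a vertex `u` to the nearest singleton. -/
noncomputable def sqDistToSingleton {n : ℕ} (S : Set (Matrix (Fin n) (Fin n) ℕ))
    (u : Fin n × Fin n) : ℕ :=
  sInf {k | ∃ s : Fin n, stepsTo (sqStep S) k u (s, s)}

/-- The diameter of the square graph of the DFA `S`: the maximum over non-singleton
vertices of the distance to the nearest singleton. -/
noncomputable def sqDiam {n : ℕ} (S : Set (Matrix (Fin n) (Fin n) ℕ)) : ℕ :=
  sSup {d | ∃ u : Fin n × Fin n, u.1 ≠ u.2 ∧ sqDistToSingleton S u = d}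


/-! Potential: distance of a pair to the nearest singleton. -/

/-- first letter on labels -/
def lq1 (n s : ℕ) : ℕ := if s = 1 then 1 else if s = n then n
    else if s % 2 = 0 then s + 1 else s - 1

/-- second letter on labels -/
def lq2 (s : ℕ) : ℕ := if s % 2 = 0 then s - 1 else s + 1

/-- third letter on labels -/
def lib (n s : ℕ) : ℕ := if s = 1 then n - 2 else s

/-- distance of the exit of the orbit `d` -/
def pC (k d : ℕ) : ℕ :=
  if d = 2 * k then 4 * k * k else if d % 2 = 0 then 3 + 2 * d + 2 * k * (d - 2)
  else 1 + 2 * k * (2 * k - 1 - d)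

/-- orbit index of a pair -/
def pD (k a b : ℕ) : ℕ :=
  if a % 2 = b % 2 then (max a b - min a b) / 2
  else if (a + b - 1) / 2 < 2 * k then (a + b - 1) / 2 else 4 * k - (a + b - 1) / 2

/-- distance to the exit in the orbit -/
def pW (k a b : ℕ) : ℕ :=
  if a % 2 ≠ b % 2 ∧ (a + b - 1) / 2 < 2 * k then
    (if pD k a b % 2 = 0 then min a b else min a b - 1)
  else (if pD k a b % 2 = 0 then min a b - 1 else min a b)

/-- the potential -/
def pF (k a b : ℕ) : ℕ := if a = b then 0 else pC k (pD k a b) + pW k a b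

lemma pC_top (k : ℕ) : pC k (2 * k) = 4 * k * k := by simp [pC]

lemma pC_r1 (k i : ℕ) (hi : i % 2 = 0) (h2 : 2 ≤ i) (h3 : i + 2 ≤ 2 * k) :
    pC k i = pC k (2 * k + 1 - i) + 2 * i + 2 := by
  obtain ⟨m, rfl⟩ : ∃ m, i = m + 2 := ⟨i - 2, by omega⟩
  have e1 : 2 * k + 1 - (m + 2) ≠ 2 * k := by omega
  have e2 : (2 * k + 1 - (m + 2)) % 2 ≠ 0 := by omega
  have e3 : 2 * k - 1 - (2 * k + 1 - (m + 2)) = m := by omega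
  have e4 : m + 2 ≠ 2 * k := by omega
  simp only [pC, e1, e2, e3, e4, hi, if_true, if_false]
  simp only [Nat.add_sub_cancel]
  ring

lemma pC_r1' (k : ℕ) (hk : 2 ≤ k) : pC k (2 * k) + 1 = pC k 1 + 4 * k := by
  obtain ⟨m, rfl⟩ : ∃ m, k = m + 1 := ⟨k - 1, by omega⟩
  have e1 : 1 ≠ 2 * (m + 1) := by omega
  have e3 : 2 * (m + 1) - 1 - 1 = 2 * m := by omega
  simp [pC, e1, e3]
  ring

lemma pC_r2 (k i : ℕ) (hi : i % 2 = 1) (h3 : i + 3 ≤ 2 * k) :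
    pC k i = pC k (2 * k - 1 - i) + 2 * i := by
  obtain ⟨m, hm⟩ : ∃ m, 2 * k = i + 3 + m := ⟨2 * k - (i + 3), by omega⟩
  have e1 : i ≠ 2 * k := by omega
  have e2 : i % 2 ≠ 0 := by omega
  have e3 : 2 * k - 1 - i = m + 2 := by omega
  have e4 : m + 2 ≠ 2 * k := by omega
  have e5 : (m + 2) % 2 = 0 := by omega
  simp only [pC, e1, e2, e3, e4, e5, if_true, if_false]
  simp only [Nat.add_sub_cancel, hm]
  ring

lemma pC_r3 (k : ℕ) (hk : 2 ≤ k) : pC k (2 * k - 1) = 1 := by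
  have e1 : 2 * k - 1 ≠ 2 * k := by omega
  have e2 : (2 * k - 1) % 2 ≠ 0 := by omega
  simp only [pC, e1, e2, if_false]
  simp

lemma pC_pos (k d : ℕ) (hk : 2 ≤ k) : 1 ≤ pC k d := by
  unfold pC
  split_ifs
  · nlinarith
  · omega
  · omega

lemma pC_bound_even (k d : ℕ) (h2 : 2 ≤ d) (hd : d + 2 ≤ 2 * k) (he : d % 2 = 0) :
    pC k d + 4 * k ≤ 4 * k * k + 2 * k + d := by
  obtain ⟨m, rfl⟩ : ∃ m, d = m + 2 := ⟨d - 2, by omega⟩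
  have e4 : m + 2 ≠ 2 * k := by omega
  simp only [pC, e4, he, if_true, if_false, Nat.add_sub_cancel]
  obtain ⟨j, hj⟩ : ∃ j, 2 * k = m + 4 + j := ⟨2 * k - (m + 4), by omega⟩
  have : 4 * k * k = 2 * k * (m + 4 + j) := by rw [← hj]; ring
  nlinarith

lemma pC_bound_odd (k d : ℕ) (hd : d + 1 ≤ 2 * k) (he : d % 2 = 1) :
    pC k d + 4 * k + 1 ≤ 4 * k * k + 2 * k + d := by
  have e4 : d ≠ 2 * k := by omega
  have e5 : d % 2 ≠ 0 := by omega
  simp only [pC, e4, e5, if_false]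
  obtain ⟨j, hj⟩ : ∃ j, 2 * k = d + 1 + j := ⟨2 * k - (d + 1), by omega⟩
  have e : 2 * k - 1 - d = j := by omega
  have : 4 * k * k = 2 * k * (d + 1 + j) := by rw [← hj]; ring
  rw [e]
  have h1 : 2 * k * 1 ≤ 2 * k * d := Nat.mul_le_mul_left _ (by omega)
  nlinarith

lemma pD_comm (k a b : ℕ) : pD k a b = pD k b a := by
  unfold pD
  split_ifs <;> omega

lemma pW_comm (k a b : ℕ) : pW k a b = pW k b a := by
  unfold pW
  rw [pD_comm k b a, min_comm b a, add_comm b a]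
  split_ifs <;> omega

lemma pF_comm (k a b : ℕ) : pF k a b = pF k b a := by
  unfold pF
  rw [pD_comm k b a, pW_comm k b a]
  split_ifs <;> omega

lemma pF_bound (k a b : ℕ) (hk : 2 ≤ k) (ha : 1 ≤ a) (han : a ≤ 4 * k) (hb : 1 ≤ b)
    (hbn : b ≤ 4 * k) : pF k a b + 1 ≤ 4 * k * k + 2 * k := by
  by_cases hab : a = b
  · simp only [pF, hab, if_true]; nlinarith
  simp only [pF, hab, if_false]
  have hD : 1 ≤ pD k a b ∧ pD k a b ≤ 2 * k := by
    unfold pD; split_ifs <;> omega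
  have hW : pW k a b + pD k a b ≤ 4 * k ∧
      (pD k a b % 2 = 0 → pW k a b + pD k a b + 1 ≤ 4 * k) := by
    unfold pW pD; split_ifs <;> omega
  by_cases ht : pD k a b = 2 * k
  · rw [ht, pC_top]; rw [ht] at hW; omega
  by_cases he : pD k a b % 2 = 0
  · have := pC_bound_even k (pD k a b) (by omega) (by omega) he
    have := hW.2 he
    omega
  · have := pC_bound_odd k (pD k a b) (by omega) (by omega)
    have := hW.1
    omega

lemma lq1_spec (n a : ℕ) (hn : n % 2 = 0) (ha : 1 ≤ a) (han : a ≤ n) :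
    (a = 1 ∧ lq1 n a = 1) ∨ (a = n ∧ lq1 n a = n) ∨
    (a % 2 = 0 ∧ a + 2 ≤ n ∧ lq1 n a = a + 1) ∨ (a % 2 = 1 ∧ 3 ≤ a ∧ lq1 n a = a - 1) := by
  unfold lq1; split_ifs <;> omega

lemma lq2_spec (a : ℕ) : (a % 2 = 0 ∧ lq2 a = a - 1) ∨ (a % 2 = 1 ∧ lq2 a = a + 1) := by
  unfold lq2; split_ifs <;> omega

lemma pD_spec (k a b : ℕ) (hab : a ≤ b) :
    (a % 2 = b % 2 ∧ pD k a b = (b - a) / 2) ∨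
    (a % 2 ≠ b % 2 ∧ (a + b - 1) / 2 < 2 * k ∧ pD k a b = (a + b - 1) / 2) ∨
    (a % 2 ≠ b % 2 ∧ 2 * k ≤ (a + b - 1) / 2 ∧ pD k a b = 4 * k - (a + b - 1) / 2) := by
  unfold pD
  rw [max_eq_right hab, min_eq_left hab]
  split_ifs <;> omega

lemma pW_spec (k a b : ℕ) (hab : a ≤ b) :
    (a % 2 ≠ b % 2 ∧ (a + b - 1) / 2 < 2 * k ∧ pD k a b % 2 = 0 ∧ pW k a b = a) ∨
    (a % 2 ≠ b % 2 ∧ (a + b - 1) / 2 < 2 * k ∧ pD k a b % 2 = 1 ∧ pW k a b = a - 1) ∨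
    ((a % 2 = b % 2 ∨ 2 * k ≤ (a + b - 1) / 2) ∧ pD k a b % 2 = 0 ∧ pW k a b = a - 1) ∨
    ((a % 2 = b % 2 ∨ 2 * k ≤ (a + b - 1) / 2) ∧ pD k a b % 2 = 1 ∧ pW k a b = a) := by
  unfold pW
  rw [min_eq_left hab]
  split_ifs <;> omega

set_option maxHeartbeats 4000000 in
lemma q1_all (k a b : ℕ) (hk : 2 ≤ k) (ha : 1 ≤ a) (hbn : b ≤ 4 * k) (hab : a < b) :
    lq1 (4 * k) a ≠ lq1 (4 * k) b ∧
    pD k (lq1 (4 * k) a) (lq1 (4 * k) b) = pD k a b ∧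
    pW k a b ≤ pW k (lq1 (4 * k) a) (lq1 (4 * k) b) + 1 ∧
    (a % 2 = 1 → pW k a b ≠ 0 → pW k a b = pW k (lq1 (4 * k) a) (lq1 (4 * k) b) + 1) := by
  have hD := pD_spec k a b hab.le
  have hW := pW_spec k a b hab.le
  have sa := lq1_spec (4 * k) a (by omega) ha (by omega)
  have sb := lq1_spec (4 * k) b (by omega) (by omega) hbn
  generalize lq1 (4 * k) a = a' at *
  generalize lq1 (4 * k) b = b' at *
  have hne : a' ≠ b' := by omega
  refine ⟨hne, ?_⟩
  rcases Nat.lt_or_gt_of_ne hne with hlt | hlt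
  · have hD' := pD_spec k a' b' hlt.le
    have hW' := pW_spec k a' b' hlt.le
    generalize pW k a' b' = w' at *
    generalize pW k a b = w at *
    have : pD k a' b' = pD k a b := by
      clear hW hW'
      rcases sa with sa | sa | sa | sa <;> rcases sb with sb | sb | sb | sb <;> omega
    refine ⟨this, ?_⟩
    rw [this] at hW' hD'
    generalize pD k a b = d at *
    rcases sa with sa | sa | sa | sa <;> rcases sb with sb | sb | sb | sb <;>
      rcases hW with hW | hW | hW | hW <;> omega
  · rw [pD_comm k a' b', pW_comm k a' b']
    have hD' := pD_spec k b' a' hlt.le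
    have hW' := pW_spec k b' a' hlt.le
    have e : b' = a ∧ a' = b := by clear hW hW' hD hD'; omega
    obtain ⟨rfl, rfl⟩ := e
    exact ⟨rfl, Nat.le_succ _, fun hp _ => by clear hW' hD' hW hD; omega⟩

set_option maxHeartbeats 4000000 in
lemma q2_all (k a b : ℕ) (hk : 2 ≤ k) (ha : 1 ≤ a) (hbn : b ≤ 4 * k) (hab : a < b) :
    lq2 a ≠ lq2 b ∧
    pD k (lq2 a) (lq2 b) = pD k a b ∧
    pW k a b ≤ pW k (lq2 a) (lq2 b) + 1 ∧
    (a % 2 = 0 → pW k a b ≠ 0 → pW k a b = pW k (lq2 a) (lq2 b) + 1) := by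
  have hD := pD_spec k a b hab.le
  have hW := pW_spec k a b hab.le
  have sa := lq2_spec a
  have sb := lq2_spec b
  generalize lq2 a = a' at *
  generalize lq2 b = b' at *
  have hne : a' ≠ b' := by omega
  refine ⟨hne, ?_⟩
  rcases Nat.lt_or_gt_of_ne hne with hlt | hlt
  · have hD' := pD_spec k a' b' hlt.le
    have hW' := pW_spec k a' b' hlt.le
    generalize pW k a' b' = w' at *
    generalize pW k a b = w at *
    have : pD k a' b' = pD k a b := by
      clear hW hW'
      rcases sa with sa | sa <;> rcases sb with sb | sb <;> omega
    refine ⟨this, ?_⟩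
    rw [this] at hW' hD'
    generalize pD k a b = d at *
    rcases sa with sa | sa <;> rcases sb with sb | sb <;>
      rcases hW with hW | hW | hW | hW <;> omega
  · rw [pD_comm k a' b', pW_comm k a' b']
    have hD' := pD_spec k b' a' hlt.le
    have hW' := pW_spec k b' a' hlt.le
    have e : b' = a ∧ a' = b := by clear hW hW' hD hD'; omega
    obtain ⟨rfl, rfl⟩ := e
    exact ⟨rfl, Nat.le_succ _, fun hp _ => by clear hW' hD' hW hD; omega⟩

lemma pF_q1 (k a b : ℕ) (hk : 2 ≤ k) (ha : 1 ≤ a) (han : a ≤ 4 * k) (hb : 1 ≤ b)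
    (hbn : b ≤ 4 * k) : pF k a b ≤ pF k (lq1 (4 * k) a) (lq1 (4 * k) b) + 1 := by
  rcases Nat.lt_trichotomy a b with hab | hab | hab
  · obtain ⟨h1, h2, h3, -⟩ := q1_all k a b hk ha hbn hab
    simp only [pF, hab.ne, h1, if_false, h2]
    omega
  · simp [pF, hab]
  · obtain ⟨h1, h2, h3, -⟩ := q1_all k b a hk hb han hab
    rw [pF_comm k a b, pF_comm k (lq1 _ a)]
    simp only [pF, hab.ne, h1, if_false, h2]
    omega

lemma pF_q2 (k a b : ℕ) (hk : 2 ≤ k) (ha : 1 ≤ a) (han : a ≤ 4 * k) (hb : 1 ≤ b)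
    (hbn : b ≤ 4 * k) : pF k a b ≤ pF k (lq2 a) (lq2 b) + 1 := by
  rcases Nat.lt_trichotomy a b with hab | hab | hab
  · obtain ⟨h1, h2, h3, -⟩ := q2_all k a b hk ha hbn hab
    simp only [pF, hab.ne, h1, if_false, h2]
    omega
  · simp [pF, hab]
  · obtain ⟨h1, h2, h3, -⟩ := q2_all k b a hk hb han hab
    rw [pF_comm k a b, pF_comm k (lq2 a)]
    simp only [pF, hab.ne, h1, if_false, h2]
    omega

lemma pF_q_desc (k a b : ℕ) (hk : 2 ≤ k) (ha : 1 ≤ a) (hbn : b ≤ 4 * k)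
    (hab : a < b) (hW : pW k a b ≠ 0) :
    pF k a b = pF k (lq1 (4 * k) a) (lq1 (4 * k) b) + 1 ∨
    pF k a b = pF k (lq2 a) (lq2 b) + 1 := by
  rcases Nat.mod_two_eq_zero_or_one a with hp | hp
  · right
    obtain ⟨h1, h2, -, h3⟩ := q2_all k a b hk ha hbn hab
    have := h3 hp hW
    simp only [pF, hab.ne, h1, if_false, h2]
    omega
  · left
    obtain ⟨h1, h2, -, h3⟩ := q1_all k a b hk ha hbn hab
    have := h3 hp hW
    simp only [pF, hab.ne, h1, if_false, h2]
    omega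

lemma pF_lib1 (k b : ℕ) (hk : 2 ≤ k) (hb : 2 ≤ b) (hbn : b ≤ 4 * k) :
    pF k 1 b ≤ pF k (4 * k - 2) b + 1 ∧
    (pW k 1 b = 0 → pF k 1 b = pF k (4 * k - 2) b + 1) := by
  have hne : 1 ≠ b := by omega
  rcases Nat.even_or_odd' b with ⟨i, rfl | rfl⟩
  · by_cases hi : i = 2 * k
    · subst hi
      have d1 : pD k 1 (2 * (2 * k)) = 2 * k := by unfold pD; split_ifs <;> omega
      have d2 : pD k (4 * k - 2) (2 * (2 * k)) = 1 := by unfold pD; split_ifs <;> omega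
      have w1 : pW k 1 (2 * (2 * k)) = 0 := by
        unfold pW; rw [d1]; split_ifs <;> omega
      have w2 : pW k (4 * k - 2) (2 * (2 * k)) = 4 * k - 2 := by
        have := pW_spec k (4 * k - 2) (2 * (2 * k)) (by omega)
        rw [d2] at this
        omega
      have hne2 : 4 * k - 2 ≠ 2 * (2 * k) := by omega
      have := pC_r1' k hk
      simp only [pF, hne, hne2, if_false, d1, d2, w1, w2]
      omega
    have d1 : pD k 1 (2 * i) = i := by unfold pD; split_ifs <;> omega
    by_cases hi2 : i = 2 * k - 1
    · subst hi2
      have w1 : pW k 1 (2 * (2 * k - 1)) = 0 := by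
        unfold pW; rw [d1]; split_ifs <;> omega
      have hne2 : 4 * k - 2 = 2 * (2 * k - 1) := by omega
      have := pC_r3 k hk
      simp only [pF, hne, hne2, if_false, if_true, d1, w1]
      omega
    have hne2 : 4 * k - 2 ≠ 2 * i := by omega
    have d2 : pD k (4 * k - 2) (2 * i) = 2 * k - 1 - i := by unfold pD; split_ifs <;> omega
    rcases Nat.mod_two_eq_zero_or_one i with hp | hp
    · have w1 : pW k 1 (2 * i) = 1 := by
        unfold pW; rw [d1]; split_ifs <;> omega
      have := pC_r2 k (2 * k - 1 - i) (by omega) (by omega)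
      have e : 2 * k - 1 - (2 * k - 1 - i) = i := by omega
      rw [e] at this
      simp only [pF, hne, hne2, if_false, d1, d2, w1]
      omega
    · have w1 : pW k 1 (2 * i) = 0 := by
        unfold pW; rw [d1]; split_ifs <;> omega
      have w2 : pW k (4 * k - 2) (2 * i) = 2 * i - 1 := by
        unfold pW; rw [d2]; split_ifs <;> omega
      have := pC_r2 k i (by omega) (by omega)
      simp only [pF, hne, hne2, if_false, d1, d2, w1, w2]
      omega
  · have hne2 : 4 * k - 2 ≠ 2 * i + 1 := by omega
    have d1 : pD k 1 (2 * i + 1) = i := by unfold pD; split_ifs <;> omega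
    have d2 : pD k (4 * k - 2) (2 * i + 1) = 2 * k + 1 - i := by
      unfold pD; split_ifs <;> omega
    rcases Nat.mod_two_eq_zero_or_one i with hp | hp
    · have w1 : pW k 1 (2 * i + 1) = 0 := by
        unfold pW; rw [d1]; split_ifs <;> omega
      have w2 : pW k (4 * k - 2) (2 * i + 1) = 2 * i + 1 := by
        unfold pW; rw [d2]; split_ifs <;> omega
      have := pC_r1 k i (by omega) (by omega) (by omega)
      simp only [pF, hne, hne2, if_false, d1, d2, w1, w2]
      omega
    · have w1 : pW k 1 (2 * i + 1) = 1 := by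
        unfold pW; rw [d1]; split_ifs <;> omega
      have hC : pC k i ≤ pC k (2 * k + 1 - i) := by
        by_cases h1 : i = 1
        · subst h1
          have := pC_r1' k hk
          simp only [Nat.add_sub_cancel]
          omega
        · have := pC_r1 k (2 * k + 1 - i) (by omega) (by omega) (by omega)
          have e : 2 * k + 1 - (2 * k + 1 - i) = i := by omega
          rw [e] at this
          omega
      simp only [pF, hne, hne2, if_false, d1, d2, w1]
      omega

lemma pF_lib (k a b : ℕ) (hk : 2 ≤ k) (ha : 1 ≤ a) (han : a ≤ 4 * k) (hb : 1 ≤ b)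
    (hbn : b ≤ 4 * k) : pF k a b ≤ pF k (lib (4 * k) a) (lib (4 * k) b) + 1 := by
  by_cases hab : a = b
  · simp [pF, hab]
  by_cases h1 : a = 1
  · subst h1
    have hb1 : b ≠ 1 := by omega
    simpa [lib, hb1] using (pF_lib1 k b hk (by omega) hbn).1
  by_cases h2 : b = 1
  · subst h2
    rw [pF_comm k a, pF_comm k (lib _ a)]
    simpa [lib, h1] using (pF_lib1 k a hk (by omega) han).1
  simp [lib, h1, h2]

lemma pF_desc (k a b : ℕ) (hk : 2 ≤ k) (ha : 1 ≤ a) (hbn : b ≤ 4 * k) (hab : a < b) :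
    pF k a b = pF k (lq1 (4 * k) a) (lq1 (4 * k) b) + 1 ∨
    pF k a b = pF k (lq2 a) (lq2 b) + 1 ∨
    pF k a b = pF k (lib (4 * k) a) (lib (4 * k) b) + 1 := by
  by_cases hW : pW k a b = 0
  · have h1 : a = 1 := by
      revert hW; unfold pW; split_ifs <;> omega
    subst h1
    have hb1 : b ≠ 1 := by omega
    right; right
    simpa [lib, hb1] using (pF_lib1 k b hk (by omega) hbn).2 hW
  · rcases pF_q_desc k a b hk ha hbn hab hW with h | h
    · exact Or.inl h
    · exact Or.inr (Or.inl h)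

lemma matOfFun_pos (n : ℕ) (f : ℕ → ℕ) (a b : Fin n) :
    0 < matOfFun n f a b ↔ f (a.val + 1) = b.val + 1 := by
  simp only [matOfFun, Matrix.of_apply]
  split_ifs with h <;> simp [h]

/-- label maps of letters of `En` -/
def IsLet (n : ℕ) (g : ℕ → ℕ) : Prop := g = lib n ∨ g = lq1 n ∨ g = lq2

lemma mem_En (n : ℕ) (A : Matrix (Fin n) (Fin n) ℕ) :
    A ∈ En n ↔ ∃ g, IsLet n g ∧ A = matOfFun n g := by
  constructor
  · rintro (h | h | h)
    · exact ⟨lib n, Or.inl rfl, h⟩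
    · exact ⟨lq1 n, Or.inr (Or.inl rfl), h⟩
    · exact ⟨lq2, Or.inr (Or.inr rfl), h⟩
  · rintro ⟨g, (rfl | rfl | rfl), h⟩
    · exact Or.inl h
    · exact Or.inr (Or.inl h)
    · exact Or.inr (Or.inr h)

lemma IsLet.range {k : ℕ} (hk : 2 ≤ k) {g : ℕ → ℕ} (hg : IsLet (4 * k) g) (a : ℕ)
    (ha : 1 ≤ a) (han : a ≤ 4 * k) : 1 ≤ g a ∧ g a ≤ 4 * k := by
  rcases hg with rfl | rfl | rfl
  · unfold lib; split_ifs <;> omega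
  · unfold lq1; split_ifs <;> omega
  · unfold lq2; split_ifs <;> omega

lemma IsLet.toFin {k : ℕ} (hk : 2 ≤ k) {g : ℕ → ℕ} (hg : IsLet (4 * k) g)
    (a : Fin (4 * k)) : ∃ b : Fin (4 * k), g (a.val + 1) = b.val + 1 := by
  have := hg.range hk (a.val + 1) (by omega) (by omega)
  exact ⟨⟨g (a.val + 1) - 1, by omega⟩, by simp only; omega⟩

/-- potential on pairs of states -/
def fF (k : ℕ) (u : Fin (4 * k) × Fin (4 * k)) : ℕ := pF k (u.1.val + 1) (u.2.val + 1)

lemma fF_step (k : ℕ) (hk : 2 ≤ k) (u v : Fin (4 * k) × Fin (4 * k))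
    (h : sqStep (En (4 * k)) u v) : fF k u ≤ fF k v + 1 := by
  obtain ⟨A, hA, h⟩ := h
  obtain ⟨g, hg, rfl⟩ := (mem_En _ _).1 hA
  simp only [matOfFun_pos] at h
  have key : fF k u ≤ pF k (g (u.1.val + 1)) (g (u.2.val + 1)) + 1 := by
    have h1 := u.1.isLt
    have h2 := u.2.isLt
    rcases hg with rfl | rfl | rfl
    · exact pF_lib k _ _ hk (by omega) (by omega) (by omega) (by omega)
    · exact pF_q1 k _ _ hk (by omega) (by omega) (by omega) (by omega)
    · exact pF_q2 k _ _ hk (by omega) (by omega) (by omega) (by omega)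
  rcases h with ⟨e1, e2⟩ | ⟨e1, e2⟩
  · rw [e1, e2] at key; exact key
  · rw [e1, e2, pF_comm] at key; exact key

lemma fF_lower (k : ℕ) (hk : 2 ≤ k) (j : ℕ) : ∀ (u : Fin (4 * k) × Fin (4 * k))
    (s : Fin (4 * k)), stepsTo (sqStep (En (4 * k))) j u (s, s) → fF k u ≤ j := by
  induction j with
  | zero =>
    intro u s h
    have : u = (s, s) := h
    simp [this, fF, pF]
  | succ j ih =>
    rintro u s ⟨w, hw, h⟩
    have := ih w s h
    have := fF_step k hk u w hw
    omega

lemma fF_desc (k : ℕ) (hk : 2 ≤ k) (u : Fin (4 * k) × Fin (4 * k)) (hu : u.1 ≠ u.2) :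
    ∃ v, sqStep (En (4 * k)) u v ∧ fF k u = fF k v + 1 := by
  have hu' : u.1.val ≠ u.2.val := fun h => hu (Fin.ext h)
  have h1 := u.1.isLt
  have h2 := u.2.isLt
  have key : ∃ g, IsLet (4 * k) g ∧
      fF k u = pF k (g (u.1.val + 1)) (g (u.2.val + 1)) + 1 := by
    rcases Nat.lt_or_gt_of_ne hu' with hlt | hlt
    · rcases pF_desc k (u.1.val + 1) (u.2.val + 1) hk (by omega) (by omega) (by omega)
        with h | h | h
      · exact ⟨_, Or.inr (Or.inl rfl), h⟩
      · exact ⟨_, Or.inr (Or.inr rfl), h⟩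
      · exact ⟨_, Or.inl rfl, h⟩
    · unfold fF
      rw [pF_comm]
      rcases pF_desc k (u.2.val + 1) (u.1.val + 1) hk (by omega) (by omega) (by omega)
        with h | h | h
      · exact ⟨_, Or.inr (Or.inl rfl), by rw [h, pF_comm]⟩
      · exact ⟨_, Or.inr (Or.inr rfl), by rw [h, pF_comm]⟩
      · exact ⟨_, Or.inl rfl, by rw [h, pF_comm]⟩
  obtain ⟨g, hg, h⟩ := key
  obtain ⟨a, ha⟩ := hg.toFin hk u.1
  obtain ⟨b, hb⟩ := hg.toFin hk u.2
  refine ⟨(a, b), ⟨matOfFun _ g, (mem_En _ _).2 ⟨g, hg, rfl⟩, Or.inl ?_⟩, ?_⟩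
  · simp only [matOfFun_pos]; exact ⟨ha, hb⟩
  · rw [h, ha, hb]; rfl

lemma fF_upper (k : ℕ) (hk : 2 ≤ k) (j : ℕ) : ∀ (u : Fin (4 * k) × Fin (4 * k)),
    fF k u = j → ∃ s, stepsTo (sqStep (En (4 * k))) j u (s, s) := by
  induction j with
  | zero =>
    intro u h
    by_cases hu : u.1 = u.2
    · exact ⟨u.1, Prod.ext rfl hu.symm⟩
    · obtain ⟨v, -, hv⟩ := fF_desc k hk u hu
      omega
  | succ j ih =>
    intro u h
    by_cases hu : u.1 = u.2
    · simp [fF, pF, hu] at h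
    · obtain ⟨v, hs, hv⟩ := fF_desc k hk u hu
      obtain ⟨s, hs'⟩ := ih v (by omega)
      exact ⟨s, v, hs, hs'⟩

lemma dist_eq (k : ℕ) (hk : 2 ≤ k) (u : Fin (4 * k) × Fin (4 * k)) :
    sqDistToSingleton (En (4 * k)) u = fF k u := by
  have hl : IsLeast {j | ∃ s, stepsTo (sqStep (En (4 * k))) j u (s, s)} (fF k u) :=
    ⟨fF_upper k hk _ u rfl, fun j ⟨s, hs⟩ => fF_lower k hk j u s hs⟩
  exact hl.csInf_eq

lemma diam_eq (k : ℕ) (hk : 2 ≤ k) : sqDiam (En (4 * k)) = 4 * k * k + 2 * k - 1 := by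
  have hg : IsGreatest {d | ∃ u : Fin (4 * k) × Fin (4 * k), u.1 ≠ u.2 ∧
      sqDistToSingleton (En (4 * k)) u = d} (4 * k * k + 2 * k - 1) := by
    constructor
    · refine ⟨(⟨2 * k - 1, by omega⟩, ⟨2 * k, by omega⟩), ?_, ?_⟩
      · intro h
        have := congrArg Fin.val h
        simp only at this
        omega
      · rw [dist_eq k hk]
        have e : 2 * k - 1 + 1 = 2 * k := by omega
        have hD : pD k (2 * k) (2 * k + 1) = 2 * k := by unfold pD; split_ifs <;> omega
        have hW : pW k (2 * k) (2 * k + 1) = 2 * k - 1 := by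
          unfold pW; rw [hD]; split_ifs <;> omega
        simp only [fF, e, pF, hD, hW, pC_top]
        split_ifs <;> omega
    · rintro d ⟨u, -, rfl⟩
      rw [dist_eq k hk]
      have h1 := u.1.isLt
      have h2 := u.2.isLt
      have := pF_bound k (u.1.val + 1) (u.2.val + 1) hk (by omega) (by omega) (by omega)
        (by omega)
      unfold fF
      omega
  exact hg.csSup_eq

lemma mul_pos_entry {n : ℕ} (A B : Matrix (Fin n) (Fin n) ℕ) (i j l : Fin n)
    (h1 : 0 < A i j) (h2 : 0 < B j l) : 0 < (A * B) i l := by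
  rw [Matrix.mul_apply]
  exact lt_of_lt_of_le (Nat.mul_pos h1 h2)
    (Finset.single_le_sum (f := fun x => A i x * B x l) (fun _ _ => Nat.zero_le _)
      (Finset.mem_univ j))

lemma word_of_steps {n : ℕ} (S : Set (Matrix (Fin n) (Fin n) ℕ)) (j : ℕ) :
    ∀ (u : Fin n × Fin n) (s : Fin n), stepsTo (sqStep S) j u (s, s) →
      ∃ ws : List (Matrix (Fin n) (Fin n) ℕ), (∀ A ∈ ws, A ∈ S) ∧
        0 < ws.prod u.1 s ∧ 0 < ws.prod u.2 s := by
  induction j with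
  | zero =>
    intro u s h
    have : u = (s, s) := h
    exact ⟨[], by simp, by simp [this]⟩
  | succ j ih =>
    rintro u s ⟨w, ⟨A, hA, hw⟩, h⟩
    obtain ⟨ws, hws, h1, h2⟩ := ih w s h
    refine ⟨A :: ws, by simpa using ⟨hA, hws⟩, ?_⟩
    rw [List.prod_cons]
    rcases hw with ⟨e1, e2⟩ | ⟨e1, e2⟩
    · exact ⟨mul_pos_entry _ _ _ _ _ e1 h1, mul_pos_entry _ _ _ _ _ e2 h2⟩
    · exact ⟨mul_pos_entry _ _ _ _ _ e1 h2, mul_pos_entry _ _ _ _ _ e2 h1⟩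

lemma word_row (k : ℕ) (hk : 2 ≤ k) (ws : List (Matrix (Fin (4 * k)) (Fin (4 * k)) ℕ))
    (hws : ∀ A ∈ ws, A ∈ En (4 * k)) : ∀ i, ∃ j, 0 < ws.prod i j := by
  induction ws with
  | nil => intro i; exact ⟨i, by simp⟩
  | cons A ws ih =>
    intro i
    obtain ⟨g, hg, rfl⟩ := (mem_En _ _).1 (hws A (by simp))
    obtain ⟨b, hb⟩ := hg.toFin hk i
    obtain ⟨j, hj⟩ := ih (fun B hB => hws B (by simp [hB])) b
    refine ⟨j, ?_⟩
    rw [List.prod_cons]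
    exact mul_pos_entry _ _ _ _ _ ((matOfFun_pos _ _ _ _).2 hb) hj

lemma sync_En (k : ℕ) (hk : 2 ≤ k) : IsSync (En (4 * k)) := by
  have key : ∀ T : Finset (Fin (4 * k)),
      ∃ ws : List (Matrix (Fin (4 * k)) (Fin (4 * k)) ℕ), ws ≠ [] ∧
        (∀ A ∈ ws, A ∈ En (4 * k)) ∧ ∃ j, ∀ i ∈ T, 0 < ws.prod i j := by
    intro T
    induction T using Finset.induction_on with
    | empty =>
      exact ⟨[Q2mat (4 * k)], by simp, by simp [En], ⟨0, by omega⟩, by simp⟩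
    | insert x T _ ih =>
      obtain ⟨ws, hne, hws, j, hj⟩ := ih
      obtain ⟨y, hy⟩ := word_row k hk ws hws x
      obtain ⟨s, hs⟩ := fF_upper k hk _ (j, y) rfl
      obtain ⟨ws', hws', h1, h2⟩ := word_of_steps _ _ _ _ hs
      refine ⟨ws ++ ws', by simp [hne], ?_, s, ?_⟩
      · intro A hA
        rcases List.mem_append.1 hA with h | h
        · exact hws A h
        · exact hws' A h
      · intro i hi
        rw [List.prod_append]
        rcases Finset.mem_insert.1 hi with rfl | hi
        · exact mul_pos_entry _ _ _ _ _ hy h2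
        · exact mul_pos_entry _ _ _ _ _ (hj i hi) h1
  obtain ⟨ws, hne, hws, j, hj⟩ := key Finset.univ
  exact ⟨ws, hne, hws, j, fun i => hj i (Finset.mem_univ i)⟩

/-- For `n = 4k`, `k ≥ 2`, the DFA `E_n = {Ī_{1,n−2}, Q₁, Q₂}` is synchronizing and the
diameter of its square graph equals `(n² + 2n − 4)/4`. -/
theorem stmt16 (n k : ℕ) (hk : 2 ≤ k) (hn : n = 4 * k) :
    IsSync (En n) ∧ 4 * sqDiam (En n) = n ^ 2 + 2 * n - 4 := by
  subst hn
  refine ⟨sync_En k hk, ?_⟩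
  rw [diam_eq k hk]
  have : (4 * k) ^ 2 = 4 * (4 * k * k) := by ring
  rw [this]
  omega
end
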